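/- arXiv:math-ph/0603066 — 2 statements merged into one kernel-verified Lean document; each statement's English description precedes it below -/
import Mathlib

section
/- Let n ≥ 2 and let g be a gauge function on ℝⁿ whose star-shaped body Q = {x : g(x) < 1} has smooth boundary with non-degenerate second fundamental form. Then there is a constant C > 0 such that for all L ≥ 1, | #{k ∈ ℤⁿ : g(k) < √L} − L^{n/2} · vol(Q) | ≤ C · L^{n/2 − n/(n+1)}, where vol(Q) is the Lebesgue measure of Q. -/
open scoped ContDiff Topology
open MeasureTheory

/-- A family of smooth maps all of whose derivatives are bounded, uniformly over the family. -/
def UniformlySmooth {ι E F : Type*} [NormedAddCommGroup E] [NormedSpace ℝ E]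
    [NormedAddCommGroup F] [NormedSpace ℝ F] (f : ι → E → F) : Prop :=
  (∀ i, ContDiff ℝ ∞ (f i)) ∧ ∀ k : ℕ, ∃ C : ℝ, ∀ i x, ‖iteratedFDeriv ℝ k (f i) x‖ ≤ C

namespace UniformlySmooth

variable {ι E F : Type*} [NormedAddCommGroup E] [NormedSpace ℝ E]
    [NormedAddCommGroup F] [NormedSpace ℝ F]

theorem exists_bound_le {f : ι → E → F} (hf : UniformlySmooth f) (n : ℕ) :
    ∃ C : ℝ, 1 ≤ C ∧ ∀ k ≤ n, ∀ i x, ‖iteratedFDeriv ℝ k (f i) x‖ ≤ C := by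
  choose C hC using hf.2
  refine ⟨1 + ∑ k ∈ Finset.range (n + 1), |C k|, ?_, fun k hk i x => ?_⟩
  · have : 0 ≤ ∑ k ∈ Finset.range (n + 1), |C k| := Finset.sum_nonneg fun _ _ => abs_nonneg _
    linarith
  · have := Finset.single_le_sum (f := fun k => |C k|) (fun _ _ => abs_nonneg _)
      (Finset.mem_range.2 (Nat.lt_succ_of_le hk))
    have h1 := hC k i x
    have h2 := le_abs_self (C k)
    linarith

theorem exists_norm_le {f : ι → E → F} (hf : UniformlySmooth f) :
    ∃ C : ℝ, ∀ i x, ‖f i x‖ ≤ C := by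
  obtain ⟨C, hC⟩ := hf.2 0
  exact ⟨C, fun i x => by simpa using hC i x⟩

theorem smul {r : ι → E → ℝ} {f : ι → E → F} (hr : UniformlySmooth r) (hf : UniformlySmooth f) :
    UniformlySmooth fun i x => r i x • f i x := by
  refine ⟨fun i => (hr.1 i).smul (hf.1 i), fun k => ?_⟩
  obtain ⟨A, hA1, hA⟩ := hr.exists_bound_le k
  obtain ⟨B, hB1, hB⟩ := hf.exists_bound_le k
  refine ⟨∑ j ∈ Finset.range (k + 1), (k.choose j : ℝ) * A * B, fun i x => ?_⟩
  refine (norm_iteratedFDeriv_smul_le (hr.1 i) (hf.1 i) x (n := k) (by exact_mod_cast le_top)).trans ?_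
  refine Finset.sum_le_sum fun j hj => ?_
  have hj' : j ≤ k := Nat.lt_succ_iff.1 (Finset.mem_range.1 hj)
  have := hA j hj' i x
  have := hB (k - j) (Nat.sub_le _ _) i x
  gcongr

theorem mul {f h : ι → E → ℂ} (hf : UniformlySmooth f) (hh : UniformlySmooth h) :
    UniformlySmooth fun i x => f i x * h i x := by
  refine ⟨fun i => (hf.1 i).mul (hh.1 i), fun k => ?_⟩
  obtain ⟨A, hA1, hA⟩ := hf.exists_bound_le k
  obtain ⟨B, hB1, hB⟩ := hh.exists_bound_le k
  refine ⟨∑ j ∈ Finset.range (k + 1), (k.choose j : ℝ) * A * B, fun i x => ?_⟩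
  refine (norm_iteratedFDeriv_mul_le (hf.1 i) (hh.1 i) x (n := k) (by exact_mod_cast le_top)).trans ?_
  refine Finset.sum_le_sum fun j hj => ?_
  have hj' : j ≤ k := Nat.lt_succ_iff.1 (Finset.mem_range.1 hj)
  have := hA j hj' i x
  have := hB (k - j) (Nat.sub_le _ _) i x
  gcongr

theorem fderiv {f : ι → E → F} (hf : UniformlySmooth f) :
    UniformlySmooth fun i x => fderiv ℝ (f i) x := by
  refine ⟨fun i => (hf.1 i).fderiv_right (m := ∞) (by simp), fun k => ?_⟩
  obtain ⟨C, hC⟩ := hf.2 (k + 1)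
  refine ⟨C, fun i x => ?_⟩
  have := hC i x
  rwa [← norm_iteratedFDeriv_fderiv] at this

theorem clm_apply {f : ι → E → E →L[ℝ] F} (hf : UniformlySmooth f) {v : ι → E} {V : ℝ}
    (hv : ∀ i, ‖v i‖ ≤ V) : UniformlySmooth fun i x => f i x (v i) := by
  refine ⟨fun i => (hf.1 i).clm_apply contDiff_const, fun k => ?_⟩
  obtain ⟨C, hC⟩ := hf.2 k
  refine ⟨V * C, fun i x => ?_⟩
  refine (norm_iteratedFDeriv_clm_apply_const (hf.1 i).contDiffAt (n := k)
    (by exact_mod_cast le_top)).trans ?_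
  exact mul_le_mul (hv i) (hC i x) (norm_nonneg _) ((norm_nonneg _).trans (hv i))

theorem neg {f : ι → E → F} (hf : UniformlySmooth f) : UniformlySmooth fun i x => -f i x := by
  refine ⟨fun i => (hf.1 i).neg, fun k => ?_⟩
  obtain ⟨C, hC⟩ := hf.2 k
  refine ⟨C, fun i x => ?_⟩
  have : iteratedFDeriv ℝ k (fun x => -f i x) x = -iteratedFDeriv ℝ k (f i) x :=
    iteratedFDeriv_neg_apply
  rw [this, norm_neg]
  exact hC i x

theorem of_hasCompactSupport {f : E → F} (hf : ContDiff ℝ ∞ f) (hc : HasCompactSupport f) :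
    UniformlySmooth fun _ : ι => f := by
  refine ⟨fun _ => hf, fun k => ?_⟩
  obtain ⟨C, hC⟩ := (hc.iteratedFDeriv (𝕜 := ℝ) k).exists_bound_of_continuous
    (hf.continuous_iteratedFDeriv (m := k) (by exact_mod_cast le_top))
  exact ⟨C, fun _ x => hC x⟩

theorem comp {G : Type*} [NormedAddCommGroup G] [NormedSpace ℝ G]
    {f : ι → E → F} (hf : UniformlySmooth f) {r : F → G} (hr : ContDiff ℝ ∞ r)
    (hc : HasCompactSupport r) : UniformlySmooth fun i x => r (f i x) := by
  refine ⟨fun i => hr.comp (hf.1 i), fun k => ?_⟩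
  obtain ⟨A, hA1, hA⟩ := (of_hasCompactSupport (ι := Unit) hr hc).exists_bound_le k
  obtain ⟨B, hB1, hB⟩ := hf.exists_bound_le k
  refine ⟨k.factorial * A * B ^ k, fun i x => ?_⟩
  refine norm_iteratedFDeriv_comp_le hr (hf.1 i) (n := k) (by exact_mod_cast le_top) x
    (fun j hj => hA j hj () _) (fun j hj1 hj => (hB j hj i x).trans (le_self_pow₀ hB1 (by omega)))

theorem comp_add_right {f : E → F} (hf : UniformlySmooth fun _ : ι => f) (u : ι → E) :
    UniformlySmooth fun i x => f (x + u i) := by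
  refine ⟨fun i => (hf.1 i).comp (contDiff_id.add contDiff_const), fun k => ?_⟩
  obtain ⟨C, hC⟩ := hf.2 k
  refine ⟨C, fun i x => ?_⟩
  rw [iteratedFDeriv_comp_add_right]
  exact hC i _

end UniformlySmooth

/-- A smooth compactly supported function that agrees with `t⁻¹` on `[1, D]`. -/
theorem exists_contDiff_eq_inv (D : ℝ) : ∃ r : ℝ → ℝ, ContDiff ℝ ∞ r ∧ HasCompactSupport r ∧
    ∀ t, 1 ≤ t → t ≤ D → r t = t⁻¹ := by
  wlog hD : 1 ≤ D generalizing D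
  · obtain ⟨r, h1, h2, h3⟩ := this 1 le_rfl
    exact ⟨r, h1, h2, fun t ht ht' => h3 t ht (by linarith)⟩
  let f : ContDiffBump ((1 + D) / 2 : ℝ) := ⟨(D - 1) / 2 + 1 / 4, (D - 1) / 2 + 1 / 2, by linarith, by linarith⟩
  refine ⟨fun t => f t * t⁻¹, ?_, f.hasCompactSupport.mul_right, fun t h1 h2 => ?_⟩
  · rw [contDiff_iff_contDiffAt]
    intro t
    by_cases ht : t = 0
    · have h0 : (0 : ℝ) ∉ tsupport f := by
        rw [f.tsupport_eq, Metric.mem_closedBall, Real.dist_eq, abs_of_nonpos (by linarith)]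
        simp only [f]
        linarith
      have : (fun t => f t * t⁻¹) =ᶠ[𝓝 t] fun _ => 0 := by
        rw [ht]
        filter_upwards [(isClosed_tsupport f).isOpen_compl.mem_nhds h0] with s hs
        simp [image_eq_zero_of_notMem_tsupport hs]
      exact contDiffAt_const.congr_of_eventuallyEq this
    · exact f.contDiffAt.mul (contDiffAt_inv ℝ ht)
  · have : f t = 1 := by
      apply f.one_of_mem_closedBall
      rw [Metric.mem_closedBall, Real.dist_eq, abs_le]
      constructor <;> simp only [f] <;> linarith
    simp [this]

section Nonstationary

variable {ι E : Type*} [NormedAddCommGroup E] [NormedSpace ℝ E] [FiniteDimensional ℝ E]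
  [MeasurableSpace E] [BorelSpace E] (μ : Measure E) [μ.IsAddHaarMeasure]

/-- Non-stationary phase, uniformly over a family of amplitudes and phases. -/
theorem exists_pow_mul_norm_integral_exp_le {S : Set E} (hS : IsCompact S)
    {Ψ : ι → E → ℝ} (hΨ : ∀ i, ContDiff ℝ ∞ (Ψ i)) {v : ι → E} {V : ℝ} (hv : ∀ i, ‖v i‖ ≤ V)
    (hD : UniformlySmooth fun i x => fderiv ℝ (Ψ i) x (v i)) (N : ℕ) :
    ∀ b : ι → E → ℂ, UniformlySmooth b → (∀ i, tsupport (b i) ⊆ S) →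
      (∀ i, ∀ x ∈ tsupport (b i), 1 ≤ fderiv ℝ (Ψ i) x (v i)) →
      ∃ C : ℝ, ∀ i, ∀ τ : ℝ, 0 < τ →
        τ ^ N * ‖∫ x, b i x * Complex.exp (Complex.I * (τ * Ψ i x : ℝ)) ∂μ‖ ≤ C := by
  have hexp : ∀ t : ℝ, ‖Complex.exp (Complex.I * (t : ℝ))‖ = 1 := fun t => by
    rw [mul_comm]; exact Complex.norm_exp_ofReal_mul_I t
  induction N with
  | zero =>
    intro b hb hbS _
    obtain ⟨C, hC⟩ := hb.exists_norm_le
    refine ⟨C * μ.real S, fun i τ _ => ?_⟩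
    rw [pow_zero, one_mul, ← setIntegral_eq_integral_of_forall_compl_eq_zero (s := S)]
    · refine norm_setIntegral_le_of_norm_le_const hS.measure_lt_top fun x _ => ?_
      rw [norm_mul, hexp, mul_one]
      exact hC i x
    · intro x hx
      rw [image_eq_zero_of_notMem_tsupport fun h => hx (hbS i h), zero_mul]
  | succ N ih =>
    intro b hb hbS hb1
    obtain ⟨D0, hD0⟩ := hD.exists_norm_le
    obtain ⟨r, hr, hrc, hr1⟩ := exists_contDiff_eq_inv D0
    set D : ι → E → ℝ := fun i x => fderiv ℝ (Ψ i) x (v i) with hDdef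
    set h : ι → E → ℂ := fun i x => r (D i x) • b i x with hh
    have hh1 : UniformlySmooth h := (hD.comp hr hrc).smul hb
    have hhs : ∀ i, tsupport (h i) ⊆ tsupport (b i) := fun i => tsupport_smul_subset_right _ _
    set c : ι → E → ℂ := fun i x => -(fderiv ℝ (h i) x (v i)) with hc
    have hc1 : UniformlySmooth c := (hh1.fderiv.clm_apply hv).neg
    have hcs : ∀ i, tsupport (c i) ⊆ tsupport (b i) := fun i => by
      refine closure_minimal ?_ (isClosed_tsupport _)
      intro x hx
      by_contra hxb
      apply hx
      have := (support_fderiv_subset ℝ (f := h i)).trans (hhs i)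
      have h0 : fderiv ℝ (h i) x = 0 := by
        by_contra h0
        exact hxb (this h0)
      simp [hc, h0]
    obtain ⟨C, hC⟩ := ih c hc1 (fun i => (hcs i).trans (hbS i)) (fun i x hx => hb1 i x (hcs i hx))
    refine ⟨C, fun i τ hτ => ?_⟩
    refine le_trans (le_of_eq ?_) (hC i τ hτ)
    set e : E → ℂ := fun x => Complex.exp (Complex.I * (τ * Ψ i x : ℝ)) with he
    have hΨd : Differentiable ℝ (Ψ i) := (hΨ i).differentiable (by simp)
    have hed : ∀ x, HasFDerivAt e
        ((e x) • (Complex.I • (Complex.ofRealCLM.comp (τ • fderiv ℝ (Ψ i) x)))) x := by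
      intro x
      have h1 : HasFDerivAt (fun x => τ * Ψ i x) (τ • fderiv ℝ (Ψ i) x) x :=
        (hΨd x).hasFDerivAt.const_mul τ
      have h2 := (Complex.ofRealCLM.hasFDerivAt (x := τ * Ψ i x)).comp x h1
      have h3 := (h2.const_mul Complex.I).cexp
      exact h3
    have hbc : HasCompactSupport (b i) := hS.of_isClosed_subset (isClosed_tsupport _) (hbS i)
    have hhc : HasCompactSupport (h i) := hS.of_isClosed_subset (isClosed_tsupport _)
      ((hhs i).trans (hbS i))
    have hec : Continuous e := by
      have := (hΨ i).continuous
      fun_prop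
    have hfe : ∀ x, fderiv ℝ e x (v i) = Complex.I * τ * D i x * e x := fun x => by
      rw [(hed x).fderiv]
      simp [hDdef]
      ring
    have hhcont := (hh1.1 i).continuous
    have hccont := (hc1.1 i).continuous
    have hDcont := (hD.1 i).continuous
    have key := integral_mul_fderiv_eq_neg_fderiv_mul_of_integrable (μ := μ) (f := h i) (g := e)
      (v := v i) ?_ ?_ ?_ (fun x _ => (hh1.1 i).differentiable (by simp) x)
      (fun x _ => (hed x).differentiableAt)
    · have e1 : ∫ x, h i x * fderiv ℝ e x (v i) ∂μ
          = Complex.I * τ * ∫ x, b i x * e x ∂μ := by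
        rw [← integral_const_mul]
        congr 1
        ext x
        rw [hfe]
        by_cases hx : x ∈ tsupport (b i)
        · have h1 := hb1 i x hx
          have h2 : r (D i x) = (D i x)⁻¹ := hr1 _ h1 ((le_abs_self _).trans (hD0 i x))
          have h3 : (D i x : ℂ) ≠ 0 := by
            have : D i x ≠ 0 := by simp only [hDdef]; linarith
            exact_mod_cast this
          simp only [hh, h2, Complex.real_smul, Complex.ofReal_inv]
          field_simp
        · have : b i x = 0 := image_eq_zero_of_notMem_tsupport hx
          simp [hh, this]
      have e2 : -∫ x, fderiv ℝ (h i) x (v i) * e x ∂μ = ∫ x, c i x * e x ∂μ := by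
        rw [← integral_neg]
        simp [hc]
      rw [e1, e2] at key
      have : τ * ‖∫ x, b i x * e x ∂μ‖ = ‖∫ x, c i x * e x ∂μ‖ := by
        rw [← key, norm_mul, norm_mul, Complex.norm_I, Complex.norm_real, Real.norm_eq_abs,
          abs_of_pos hτ, one_mul]
      rw [pow_succ, mul_assoc, this]
    · have : Continuous fun x => fderiv ℝ (h i) x (v i) := by
        have := continuous_neg.comp hccont
        simpa only [hc, Function.comp_def, neg_neg] using this
      refine (this.mul hec).integrable_of_hasCompactSupport ?_
      refine HasCompactSupport.mul_right ?_
      exact (hhc.fderiv (𝕜 := ℝ)).comp_left (g := fun L : E →L[ℝ] ℂ => L (v i)) rfl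
    · simp_rw [hfe]
      refine Continuous.integrable_of_hasCompactSupport ?_ hhc.mul_right
      fun_prop
    · exact (hhcont.mul hec).integrable_of_hasCompactSupport hhc.mul_right

end Nonstationary

theorem UniformlySmooth.difference_quotient {E F : Type*} [NormedAddCommGroup E] [NormedSpace ℝ E]
    [NormedAddCommGroup F] [NormedSpace ℝ F] {f : E → F}
    (hf : UniformlySmooth fun _ : Unit => f) :
    UniformlySmooth fun (u : {u : E // u ≠ 0}) x => ‖(u : E)‖⁻¹ • (f x - f (x - u)) := by
  have hf0 : ContDiff ℝ ∞ f := hf.1 ()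
  have hsub : ∀ u : E, ContDiff ℝ ∞ fun x => f (x - u) := fun u =>
    hf0.comp (contDiff_id.sub contDiff_const)
  refine ⟨fun u => contDiff_const.smul (hf0.sub (hsub u)), fun k => ?_⟩
  obtain ⟨C, hC⟩ := hf.2 (k + 1)
  refine ⟨C, fun u x => ?_⟩
  have hu : 0 < ‖(u : E)‖ := norm_pos_iff.2 u.2
  have hk : ∀ {h : E → F} {y : E}, ContDiff ℝ ∞ h → ContDiffAt ℝ k h y := fun hh =>
    (hh.of_le (by exact_mod_cast le_top)).contDiffAt
  have e1 : iteratedFDeriv ℝ k (fun x => ‖(u : E)‖⁻¹ • (f x - f (x - u))) x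
      = ‖(u : E)‖⁻¹ • (iteratedFDeriv ℝ k f x - iteratedFDeriv ℝ k f (x - u)) := by
    have h1 : iteratedFDeriv ℝ k (fun x => ‖(u : E)‖⁻¹ • (f x - f (x - u))) x
        = ‖(u : E)‖⁻¹ • iteratedFDeriv ℝ k (fun x => f x - f (x - u)) x :=
      iteratedFDeriv_const_smul_apply (hk (hf0.sub (hsub u)))
    have h2 : iteratedFDeriv ℝ k (fun x => f x - f (x - u)) x
        = iteratedFDeriv ℝ k f x - iteratedFDeriv ℝ k (fun x => f (x - u)) x :=
      iteratedFDeriv_sub_apply (hk hf0) (hk (hsub u))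
    rw [h1, h2, iteratedFDeriv_comp_sub]
  rw [e1, norm_smul, norm_inv, norm_norm, inv_mul_le_iff₀ hu, mul_comm]
  have h3 := Convex.norm_image_sub_le_of_norm_fderiv_le (𝕜 := ℝ) (f := iteratedFDeriv ℝ k f)
    (s := Set.univ) (C := C) (x := x - u) (y := x)
    (fun y _ => (hf0.differentiable_iteratedFDeriv (m := k) (by exact_mod_cast ENat.natCast_lt_top k)) y)
    (fun y _ => by rw [norm_fderiv_iteratedFDeriv]; exact hC () y) convex_univ trivial trivial
  simpa using h3

section Stationary

variable {E : Type*} [NormedAddCommGroup E] [NormedSpace ℝ E] [FiniteDimensional ℝ E]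

theorem exists_direction {φ : E → ℝ} (hφ : ContDiff ℝ ∞ φ) {z₀ : E}
    (hnd : ∀ u, (∀ w, fderiv ℝ (fderiv ℝ φ) z₀ u w = 0) → u = 0) :
    ∃ r > 0, ∃ V : ℝ, ∃ v : {u : E // u ≠ 0} → E, (∀ u, ‖v u‖ ≤ V) ∧
      ∀ (u : {u : E // u ≠ 0}) (x : E), x ∈ Metric.ball z₀ r → x - u ∈ Metric.ball z₀ r →
        ‖(u : E)‖ ≤ (fderiv ℝ φ x - fderiv ℝ φ (x - u)) (v u) := by
  set B := fderiv ℝ (fderiv ℝ φ) z₀ with hB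
  have hker : LinearMap.ker (B : E →ₗ[ℝ] E →L[ℝ] ℝ) = ⊥ := by
    rw [LinearMap.ker_eq_bot']
    intro u hu
    apply hnd
    intro w
    have : B u = 0 := hu
    rw [this]; simp
  obtain ⟨K, hK, hKB⟩ := (B : E →ₗ[ℝ] E →L[ℝ] ℝ).exists_antilipschitzWith hker
  have hK0 : (0 : ℝ) < K := by exact_mod_cast hK
  have hanti : ∀ u, ‖u‖ ≤ K * ‖B u‖ := fun u => by
    simpa using hKB.le_mul_dist u 0
  set c : ℝ := 1 / (4 * K) with hc
  have hc0 : 0 < c := by positivity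
  have hdir : ∀ u : {u : E // u ≠ 0}, ∃ v, ‖v‖ ≤ c⁻¹ ∧ 2 * ‖(u : E)‖ ≤ B u v := by
    intro u
    have hu : 0 < ‖(u : E)‖ := norm_pos_iff.2 u.2
    have h1 : 2 * c * ‖(u : E)‖ < ‖B u‖ := by
      have h2 := hanti u
      have h3 : 2 * c * ‖(u : E)‖ = ‖(u : E)‖ / (2 * K) := by rw [hc]; field_simp; ring
      rw [h3, div_lt_iff₀ (by positivity)]
      nlinarith
    obtain ⟨w, hw1, hw⟩ := (B u).exists_lt_apply_of_lt_opNorm h1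
    rw [Real.norm_eq_abs] at hw
    have key : ∀ w : E, ‖w‖ < 1 → 2 * c * ‖(u : E)‖ < B u w →
        ∃ v, ‖v‖ ≤ c⁻¹ ∧ 2 * ‖(u : E)‖ ≤ B u v := by
      intro w hw1 hw
      refine ⟨c⁻¹ • w, ?_, ?_⟩
      · rw [norm_smul, norm_inv, Real.norm_of_nonneg hc0.le]
        exact mul_le_of_le_one_right (by positivity) hw1.le
      · rw [map_smul, smul_eq_mul, le_inv_mul_iff₀ hc0]
        linarith
    rcases abs_cases (B u w) with ⟨h, _⟩ | ⟨h, _⟩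
    · exact key w hw1 (h ▸ hw)
    · exact key (-w) (by rwa [norm_neg]) (by rw [map_neg]; exact h ▸ hw)
  choose v hv1 hv2 using hdir
  have hstrict : HasStrictFDerivAt (fderiv ℝ φ) B z₀ :=
    ((hφ.fderiv_right (m := ∞) (by simp)).contDiffAt).hasStrictFDerivAt (by simp)
  have hev := hstrict.isLittleO.def hc0
  obtain ⟨r, hr, hball⟩ := Metric.eventually_nhds_iff_ball.1 hev
  refine ⟨r, hr, c⁻¹, v, hv1, fun u x hx hxu => ?_⟩
  have h1 := hball (x, x - u) (by
    rw [← ball_prod_same]; exact ⟨hx, hxu⟩)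
  simp only [sub_sub_cancel] at h1
  have h2 := ((fderiv ℝ φ x - fderiv ℝ φ (x - u) - B u).le_opNorm (v u)).trans
    (mul_le_mul h1 (hv1 u) (norm_nonneg _) (by positivity))
  have h3 : c * ‖(u : E)‖ * c⁻¹ = ‖(u : E)‖ := by field_simp
  rw [h3, Real.norm_eq_abs] at h2
  have h4 := (abs_le.1 h2).1
  have h5 := hv2 u
  rw [_root_.sub_apply] at h4
  linarith

variable [MeasurableSpace E] [BorelSpace E] (μ : Measure E) [μ.IsAddHaarMeasure]

open Module in
theorem exists_ball_norm_integral_le_aux [Nontrivial E] {φ : E → ℝ} (hφ : ContDiff ℝ ∞ φ)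
    (hφc : HasCompactSupport φ) {z₀ : E}
    (hnd : ∀ u, (∀ w, fderiv ℝ (fderiv ℝ φ) z₀ u w = 0) → u = 0) :
    ∃ r > 0, ∀ a : E → ℂ, ContDiff ℝ ∞ a → tsupport a ⊆ Metric.ball z₀ r →
      ∃ C : ℝ, ∀ t : ℝ, 0 < t → ∀ l : E →L[ℝ] ℝ,
        ‖∫ x, a x * Complex.exp (Complex.I * (t * φ x + l x : ℝ)) ∂μ‖
          ≤ C * t ^ (-(finrank ℝ E / 2 : ℝ)) := by
  obtain ⟨r, hr, V, v, hvV, hv⟩ := exists_direction hφ hnd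
  refine ⟨r, hr, fun a ha has => ?_⟩
  have hac : HasCompactSupport a :=
    (isCompact_closedBall z₀ r).of_isClosed_subset (isClosed_tsupport _)
      (has.trans Metric.ball_subset_closedBall)
  set Ψ : {u : E // u ≠ 0} → E → ℝ := fun u x => ‖(u : E)‖⁻¹ * (φ x - φ (x - u)) with hΨ
  have hφsub : ∀ u : E, ContDiff ℝ ∞ fun x => φ (x - u) := fun u =>
    hφ.comp (contDiff_id.sub contDiff_const)
  have hΨs : ∀ u, ContDiff ℝ ∞ (Ψ u) := fun u => contDiff_const.mul (hφ.sub (hφsub u))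
  have hΨd : ∀ u x, fderiv ℝ (Ψ u) x = ‖(u : E)‖⁻¹ • (fderiv ℝ φ x - fderiv ℝ φ (x - u)) := by
    intro u x
    have h1 : HasFDerivAt φ (fderiv ℝ φ x) x := (hφ.differentiable (by simp) x).hasFDerivAt
    have h2 : HasFDerivAt φ (fderiv ℝ φ (x - u)) (x - u) :=
      (hφ.differentiable (by simp) _).hasFDerivAt
    have h3 : HasFDerivAt (fun x => φ (x - u)) (fderiv ℝ φ (x - u)) x :=
      (hasFDerivAt_comp_sub (u : E)).2 h2
    exact ((h1.sub h3).const_mul _).fderiv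
  have hD : UniformlySmooth fun u x => fderiv ℝ (Ψ u) x (v u) := by
    simp_rw [hΨd]
    refine UniformlySmooth.clm_apply
      (f := fun (u : {u : E // u ≠ 0}) x => ‖(u : E)‖⁻¹ • (fderiv ℝ φ x - fderiv ℝ φ (x - u)))
      ?_ hvV
    exact (UniformlySmooth.of_hasCompactSupport hφ hφc).fderiv.difference_quotient
  set b : {u : E // u ≠ 0} → E → ℂ := fun u x => a x * (starRingEnd ℂ) (a (x - u)) with hb
  have hau : UniformlySmooth fun _ : {u : E // u ≠ 0} => a :=
    UniformlySmooth.of_hasCompactSupport ha hac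
  have hacu : UniformlySmooth fun _ : {u : E // u ≠ 0} => fun x => (starRingEnd ℂ) (a x) :=
    UniformlySmooth.of_hasCompactSupport (Complex.conjCLE.contDiff.comp ha)
      (hac.comp_left (map_zero _))
  have hbu : UniformlySmooth b := by
    refine hau.mul ?_
    simpa [sub_eq_add_neg] using hacu.comp_add_right fun u => -(u : E)
  have hbs : ∀ u, ∀ x ∈ tsupport (b u), x ∈ tsupport a ∧ x - u ∈ tsupport a := by
    intro u x hx
    refine ⟨tsupport_mul_subset_left hx, ?_⟩
    have h1 : tsupport (b u) ⊆ (fun x => x - (u : E)) ⁻¹' tsupport a := by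
      refine closure_minimal (fun y hy => ?_)
        ((isClosed_tsupport a).preimage (continuous_id.sub continuous_const))
      apply subset_tsupport
      intro h0
      apply hy
      simp [hb, h0]
    exact h1 hx
  have hb1 : ∀ u, ∀ x ∈ tsupport (b u), 1 ≤ fderiv ℝ (Ψ u) x (v u) := by
    intro u x hx
    obtain ⟨h1, h2⟩ := hbs u x hx
    have hu : 0 < ‖(u : E)‖ := norm_pos_iff.2 u.2
    rw [hΨd, _root_.smul_apply, smul_eq_mul, le_inv_mul_iff₀ hu, mul_one]
    exact hv u x (has h1) (has h2)
  have hB := fun N => exists_pow_mul_norm_integral_exp_le μ hac hΨs hvV hD N b hbu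
    (fun u x hx => (hbs u x hx).1) hb1
  set N := finrank ℝ E + 1 with hN
  obtain ⟨C₀, hC₀⟩ := hB 0
  obtain ⟨C₁, hC₁⟩ := hB N
  set C := 2 ^ N * (C₀ + C₁) with hC
  set J : ℝ := ∫ x : E, (1 + ‖x‖) ^ (-(N : ℝ)) ∂μ with hJ
  have hJ0 : 0 ≤ J := integral_nonneg fun x => by positivity
  have hJi : Integrable (fun x : E => (1 + ‖x‖) ^ (-(N : ℝ))) μ :=
    integrable_one_add_norm (by simp [hN])
  have hest : ∀ (u : {u : E // u ≠ 0}) (t : ℝ), 0 < t →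
      ‖∫ x, b u x * Complex.exp (Complex.I * ((t * ‖(u : E)‖) * Ψ u x : ℝ)) ∂μ‖
        ≤ C * (1 + ‖t • (u : E)‖) ^ (-(N : ℝ)) := by
    intro u t ht
    have hu : 0 < ‖(u : E)‖ := norm_pos_iff.2 u.2
    have hτ : 0 < t * ‖(u : E)‖ := by positivity
    have h0 := hC₀ u _ hτ
    have h1 := hC₁ u _ hτ
    rw [pow_zero, one_mul] at h0
    set X := ‖∫ x, b u x * Complex.exp (Complex.I * ((t * ‖(u : E)‖) * Ψ u x : ℝ)) ∂μ‖
    rw [norm_smul, Real.norm_of_nonneg ht.le, Real.rpow_neg (by positivity), Real.rpow_natCast,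
      ← div_eq_mul_inv, le_div_iff₀ (by positivity)]
    have hX : 0 ≤ X := norm_nonneg _
    set τ := t * ‖(u : E)‖
    have h2 : (1 + τ) ^ N ≤ 2 ^ N * (1 + τ ^ N) := by
      have h3 := add_pow_le (zero_le_one (α := ℝ)) hτ.le N
      rw [one_pow] at h3
      refine h3.trans ?_
      have : (2 : ℝ) ^ (N - 1) ≤ 2 ^ N := pow_le_pow_right₀ (by norm_num) (by omega)
      gcongr
    calc X * (1 + τ) ^ N ≤ X * (2 ^ N * (1 + τ ^ N)) := by gcongr
      _ = 2 ^ N * (X + τ ^ N * X) := by ring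
      _ ≤ 2 ^ N * (C₀ + C₁) := by gcongr
  refine ⟨Real.sqrt (C * J), fun t ht l => ?_⟩
  set F : E → ℂ := fun x => a x * Complex.exp (Complex.I * (t * φ x + l x : ℝ)) with hF
  have hFc : Continuous F := by
    have := ha.continuous
    have := hφ.continuous
    fun_prop
  have hFi : Integrable F μ := hFc.integrable_of_hasCompactSupport hac.mul_right
  have hgi : Integrable (fun x => (starRingEnd ℂ) (F (-x))) μ := by
    have h1 : Integrable (fun x => F (-x)) μ := hFi.comp_neg
    exact (Complex.conjCLE.toContinuousLinearMap).integrable_comp h1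
  have hconv := integral_convolution (μ := μ) (ν := μ) (ContinuousLinearMap.mul ℝ ℂ) hFi hgi
  have hright : ∫ x, (starRingEnd ℂ) (F (-x)) ∂μ = (starRingEnd ℂ) (∫ x, F x ∂μ) := by
    rw [integral_conj, integral_neg_eq_self (μ := μ) F]
  rw [hright, ContinuousLinearMap.mul_apply', Complex.mul_conj] at hconv
  have hpt : ∀ u, u ≠ 0 → ‖(convolution F (fun x => (starRingEnd ℂ) (F (-x)))
      (ContinuousLinearMap.mul ℝ ℂ) μ) u‖ ≤ C * (1 + ‖t • u‖) ^ (-(N : ℝ)) := by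
    intro u hu
    refine le_trans (le_of_eq ?_) (hest ⟨u, hu⟩ t ht)
    rw [convolution_def]
    have hu' : ‖u‖ ≠ 0 := norm_ne_zero_iff.2 hu
    have : ∀ x, (ContinuousLinearMap.mul ℝ ℂ) (F x) ((starRingEnd ℂ) (F (-(u - x))))
        = Complex.exp (Complex.I * (l u : ℝ)) * (b ⟨u, hu⟩ x *
          Complex.exp (Complex.I * ((t * ‖u‖) * Ψ ⟨u, hu⟩ x : ℝ))) := by
      intro x
      have e1 : (t * ‖u‖) * Ψ ⟨u, hu⟩ x = t * (φ x - φ (x - u)) := by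
        simp only [hΨ]; field_simp
      rw [e1, ContinuousLinearMap.mul_apply', neg_sub]
      simp only [hF, hb, map_mul, ← Complex.exp_conj, Complex.conj_I, Complex.conj_ofReal]
      have e2 : Complex.exp (Complex.I * (t * φ x + l x : ℝ)) *
          Complex.exp (-Complex.I * (t * φ (x - u) + l (x - u) : ℝ))
          = Complex.exp (Complex.I * (l u : ℝ)) *
            Complex.exp (Complex.I * (t * (φ x - φ (x - u)) : ℝ)) := by
        rw [← Complex.exp_add, ← Complex.exp_add]
        congr 1
        rw [map_sub]
        push_cast
        ring
      linear_combination (a x * (starRingEnd ℂ) (a (x - u))) * e2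
    simp_rw [this]
    rw [integral_const_mul, norm_mul, mul_comm Complex.I, Complex.norm_exp_ofReal_mul_I, one_mul]
  have hint : Integrable (fun u : E => C * (1 + ‖t • u‖) ^ (-(N : ℝ))) μ :=
    (hJi.comp_smul ht.ne').const_mul C
  have hsq : ‖∫ x, F x ∂μ‖ ^ 2 ≤ C * J * t ^ (-(finrank ℝ E : ℝ)) := by
    calc ‖∫ x, F x ∂μ‖ ^ 2 = ‖((Complex.normSq (∫ x, F x ∂μ) : ℝ) : ℂ)‖ := by
          rw [Complex.norm_real, Real.norm_of_nonneg (Complex.normSq_nonneg _),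
            Complex.normSq_eq_norm_sq]
      _ ≤ ∫ u, C * (1 + ‖t • u‖) ^ (-(N : ℝ)) ∂μ := by
          rw [← hconv]
          refine norm_integral_le_of_norm_le hint ?_
          filter_upwards [measure_eq_zero_iff_ae_notMem.1 (measure_singleton (μ := μ) (0 : E))]
            with u hu
          exact hpt u hu
      _ = C * J * t ^ (-(finrank ℝ E : ℝ)) := by
          rw [integral_const_mul, Measure.integral_comp_smul μ
            (fun u : E => (1 + ‖u‖) ^ (-(N : ℝ))) t, Real.rpow_neg ht.le, Real.rpow_natCast,
            abs_of_pos (by positivity), smul_eq_mul]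
          ring
  have hsq2 : t ^ (-(finrank ℝ E : ℝ)) = (t ^ (-(finrank ℝ E / 2 : ℝ))) ^ 2 := by
    rw [← Real.rpow_natCast, ← Real.rpow_mul ht.le]
    congr 1
    push_cast
    ring
  have hpos : 0 ≤ t ^ (-(finrank ℝ E / 2 : ℝ)) := by positivity
  have := Real.sqrt_le_sqrt hsq
  rwa [Real.sqrt_sq (norm_nonneg _), hsq2, mul_comm, Real.sqrt_mul (by positivity),
    Real.sqrt_sq hpos, mul_comm] at this

open Module in
/-- Oscillatory integrals near a point where the Hessian of the phase is non-degenerate. The bound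
is uniform with respect to linear perturbations of the phase. -/
theorem exists_ball_norm_integral_le [Nontrivial E] {φ : E → ℝ} (hφ : ContDiff ℝ ∞ φ) {z₀ : E}
    (hnd : ∀ u, (∀ w, fderiv ℝ (fderiv ℝ φ) z₀ u w = 0) → u = 0) :
    ∃ r > 0, ∀ a : E → ℂ, ContDiff ℝ ∞ a → tsupport a ⊆ Metric.ball z₀ r →
      ∃ C : ℝ, ∀ t : ℝ, 0 < t → ∀ l : E →L[ℝ] ℝ,
        ‖∫ x, a x * Complex.exp (Complex.I * (t * φ x + l x : ℝ)) ∂μ‖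
          ≤ C * t ^ (-(finrank ℝ E / 2 : ℝ)) := by
  let f : ContDiffBump z₀ := ⟨1, 2, by norm_num, by norm_num⟩
  have hloc : (fun x => f x * φ x) =ᶠ[𝓝 z₀] φ := by
    filter_upwards [f.eventuallyEq_one] with x hx
    simp [hx]
  have hnd' : ∀ u, (∀ w, fderiv ℝ (fderiv ℝ fun x => f x * φ x) z₀ u w = 0) → u = 0 := by
    rw [hloc.fderiv.fderiv_eq]
    exact hnd
  obtain ⟨r, hr, h⟩ := exists_ball_norm_integral_le_aux μ (f.contDiff.mul hφ)
    f.hasCompactSupport.mul_right hnd'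
  refine ⟨min r 1, lt_min hr one_pos, fun a ha has => ?_⟩
  obtain ⟨C, hC⟩ := h a ha (has.trans (Metric.ball_subset_ball (min_le_left _ _)))
  refine ⟨C, fun t ht l => le_trans (le_of_eq ?_) (hC t ht l)⟩
  congr 2
  ext x
  by_cases hx : x ∈ tsupport a
  · have : f x = 1 := f.one_of_mem_closedBall
      (Metric.ball_subset_closedBall (Metric.ball_subset_ball (min_le_right _ _) (has hx)))
    simp [this]
  · simp [image_eq_zero_of_notMem_tsupport hx]

end Stationary

section Localization

variable {E : Type*} [NormedAddCommGroup E] [NormedSpace ℝ E]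

/-- Additive properties of smooth compactly supported functions pass to finite sums. -/
theorem smooth_sum_induction {P : (E → ℂ) → Prop} (hzero : P 0)
    (hadd : ∀ b c : E → ℂ, ContDiff ℝ ∞ b → HasCompactSupport b → ContDiff ℝ ∞ c →
      HasCompactSupport c → P b → P c → P (b + c)) {ι : Type*} (s : Finset ι) (u : ι → E → ℂ)
    (hu : ∀ i, ContDiff ℝ ∞ (u i)) (huc : ∀ i, HasCompactSupport (u i)) (hP : ∀ i, P (u i)) :
    P (∑ i ∈ s, u i) ∧ ContDiff ℝ ∞ (∑ i ∈ s, u i) ∧ HasCompactSupport (∑ i ∈ s, u i) := by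
  classical
  induction s using Finset.induction_on with
  | empty =>
    rw [Finset.sum_empty]
    exact ⟨hzero, contDiff_const, HasCompactSupport.zero⟩
  | insert i s hi ih =>
    rw [Finset.sum_insert hi]
    obtain ⟨h1, h2, h3⟩ := ih
    exact ⟨hadd _ _ (hu i) (huc i) h2 h3 (hP i) h1, (hu i).add h2, (huc i).add h3⟩

variable [FiniteDimensional ℝ E]

open scoped Manifold in
theorem exists_partition {K : Set E} (hK : IsCompact K) {r : E → ℝ} (hr : ∀ z, 0 < r z) :
    ∃ (t : Finset E) (f : t → E → ℝ), (∀ i : t, (i : E) ∈ K) ∧ (∀ i, ContDiff ℝ ∞ (f i)) ∧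
      (∀ i : t, tsupport (f i) ⊆ Metric.ball (i : E) (r i)) ∧ ∀ x ∈ K, ∑ i, f i x = 1 := by
  obtain ⟨t, hta, ht⟩ := hK.elim_nhds_subcover (fun z => Metric.ball z (r z))
    (fun z _ => Metric.ball_mem_nhds z (hr z))
  obtain ⟨f, hf⟩ := SmoothPartitionOfUnity.exists_isSubordinate 𝓘(ℝ, E)
    hK.isClosed (fun z : t => Metric.ball (z : E) (r z)) (fun z => Metric.isOpen_ball)
    (by simpa [Set.iUnion_subtype] using ht)
  refine ⟨t, fun i => f i, fun i => hta i i.2, fun i => (f i).contMDiff.contDiff, hf,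
    fun x hx => ?_⟩
  rw [← finsum_eq_sum_of_fintype]
  exact f.sum_eq_one hx

/-- An additive property of smooth compactly supported functions can be checked on functions with
small support. -/
theorem smooth_localization {P : (E → ℂ) → Prop} (hzero : P 0)
    (hadd : ∀ b c : E → ℂ, ContDiff ℝ ∞ b → HasCompactSupport b → ContDiff ℝ ∞ c →
      HasCompactSupport c → P b → P c → P (b + c))
    {a : E → ℂ} (ha : ContDiff ℝ ∞ a) (hac : HasCompactSupport a)
    (hloc : ∀ z ∈ tsupport a, ∃ r > 0, ∀ b : E → ℂ, ContDiff ℝ ∞ b → HasCompactSupport b →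
      tsupport b ⊆ Metric.ball z r → P b) : P a := by
  have hloc' : ∀ z, ∃ r > 0, z ∈ tsupport a → ∀ b : E → ℂ, ContDiff ℝ ∞ b →
      HasCompactSupport b → tsupport b ⊆ Metric.ball z r → P b := by
    intro z
    by_cases hz : z ∈ tsupport a
    · obtain ⟨r, hr, h⟩ := hloc z hz
      exact ⟨r, hr, fun _ => h⟩
    · exact ⟨1, one_pos, fun h => absurd h hz⟩
  choose r hr h using hloc'
  obtain ⟨t, f, hta, hfs, hf, hf1⟩ := exists_partition hac.isCompact hr
  have hsm : ∀ i, ContDiff ℝ ∞ (f i • a) := fun i => (hfs i).smul ha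
  have hcs : ∀ i, HasCompactSupport (f i • a) := fun i => hac.smul_left
  have hsum : a = ∑ i : t, f i • a := by
    ext x
    simp only [Finset.sum_apply, Pi.smul_apply']
    rw [← Finset.sum_smul]
    by_cases hx : x ∈ tsupport a
    · rw [hf1 x hx, one_smul]
    · rw [image_eq_zero_of_notMem_tsupport hx, smul_zero]
  rw [hsum]
  exact (smooth_sum_induction hzero hadd Finset.univ _ hsm hcs fun i =>
    h i (hta i) _ (hsm i) (hcs i) ((tsupport_smul_subset_left _ _).trans (hf i))).1

end Localization

namespace UniformlySmooth

variable {ι E F : Type*} [NormedAddCommGroup E] [NormedSpace ℝ E]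
    [NormedAddCommGroup F] [NormedSpace ℝ F]

theorem const {c : ι → F} {C : ℝ} (hc : ∀ i, ‖c i‖ ≤ C) :
    UniformlySmooth fun i (_ : E) => c i := by
  refine ⟨fun i => contDiff_const, fun k => ⟨max C 0, fun i x => ?_⟩⟩
  rcases Nat.eq_zero_or_pos k with rfl | hk
  · simpa using Or.inl (hc i)
  · rw [iteratedFDeriv_const_of_ne hk.ne']
    simp

theorem add {f h : ι → E → F} (hf : UniformlySmooth f) (hh : UniformlySmooth h) :
    UniformlySmooth fun i x => f i x + h i x := by
  refine ⟨fun i => (hf.1 i).add (hh.1 i), fun k => ?_⟩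
  obtain ⟨A, hA⟩ := hf.2 k
  obtain ⟨B, hB⟩ := hh.2 k
  refine ⟨A + B, fun i x => ?_⟩
  have e1 : iteratedFDeriv ℝ k (fun x => f i x + h i x) x
      = iteratedFDeriv ℝ k (f i) x + iteratedFDeriv ℝ k (h i) x :=
    iteratedFDeriv_add_apply ((hf.1 i).of_le (by exact_mod_cast le_top)).contDiffAt
      ((hh.1 i).of_le (by exact_mod_cast le_top)).contDiffAt
  rw [e1]
  exact norm_add_le_of_le (hA i x) (hB i x)

end UniformlySmooth

theorem integrable_amplitude_mul_exp {E : Type*} [NormedAddCommGroup E] [MeasurableSpace E]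
    [BorelSpace E] (μ : Measure E) [IsFiniteMeasureOnCompacts μ] {a : E → ℂ} (ha : Continuous a)
    (hac : HasCompactSupport a) {Ψ : E → ℝ} (hΨ : Continuous Ψ) :
    Integrable (fun x => a x * Complex.exp (Complex.I * (Ψ x : ℝ))) μ := by
  refine Continuous.integrable_of_hasCompactSupport ?_ hac.mul_right
  fun_prop

section Far

variable {V : Type*} [NormedAddCommGroup V] [NormedSpace ℝ V] [FiniteDimensional ℝ V]
  [MeasurableSpace V] [BorelSpace V] (μ : Measure V) [μ.IsAddHaarMeasure]

theorem exists_ball_far_bound {G : V → ℝ} (hG : ContDiff ℝ ∞ G) {m₁ m₂ : ℝ} (hm₁ : 0 < m₁)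
    (hm₂ : 0 < m₂) {x₀ : V} (h₁ : m₁ ≤ ‖fderiv ℝ G x₀‖) (h₂ : ‖fderiv ℝ G x₀‖ ≤ m₂) :
    ∃ r > 0, ∀ b : V → ℂ, ContDiff ℝ ∞ b → HasCompactSupport b → tsupport b ⊆ Metric.ball x₀ r →
      ∀ N : ℕ, ∃ C : ℝ, ∀ (ξ : V →L[ℝ] ℝ) (m : ℝ), ξ ≠ 0 →
        (|m| ≤ 1 / (2 * m₂) ∨ 2 / m₁ ≤ |m|) →
        (‖ξ‖ * (1 + |m|)) ^ N *
          ‖∫ x, b x * Complex.exp (Complex.I * (‖ξ‖ * (m * G x) - ξ x : ℝ)) ∂μ‖ ≤ C := by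
  let f : ContDiffBump x₀ := ⟨1, 2, by norm_num, by norm_num⟩
  set H : V → ℝ := fun x => f x * G x with hH
  have hHs : ContDiff ℝ ∞ H := f.contDiff.mul hG
  have hHc : HasCompactSupport H := f.hasCompactSupport.mul_right
  have hloc : H =ᶠ[𝓝 x₀] G := by
    filter_upwards [f.eventuallyEq_one] with x hx
    simp [hH, hx]
  rw [← hloc.fderiv_eq] at h₁ h₂
  let ι := {p : ℝ × (V →L[ℝ] ℝ) // ‖p.2‖ = 1 ∧ (|p.1| ≤ 1 / (2 * m₂) ∨ 2 / m₁ ≤ |p.1|)}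
  set κ : ℝ := min (1 / 2 / (1 + 1 / (2 * m₂))) (m₁ / 2 / (1 + m₁ / 2)) with hκ
  have hκ0 : 0 < κ := by positivity
  have hlow : ∀ i : ι, κ * (1 + |i.1.1|) ≤ ‖i.1.1 • fderiv ℝ H x₀ - i.1.2‖ := by
    rintro ⟨⟨m, θ⟩, hθ, hm⟩
    simp only at hθ hm ⊢
    rcases hm with hm | hm
    · have e1 : ‖θ‖ - ‖m • fderiv ℝ H x₀‖ ≤ ‖m • fderiv ℝ H x₀ - θ‖ := by
        rw [norm_sub_rev]; exact norm_sub_norm_le _ _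
      rw [hθ, norm_smul, Real.norm_eq_abs] at e1
      have e2 : |m| * ‖fderiv ℝ H x₀‖ ≤ 1 / (2 * m₂) * m₂ := by gcongr
      have e3 : 1 / (2 * m₂) * m₂ = 1 / 2 := by field_simp
      have e4 : κ * (1 + |m|) ≤ 1 / 2 / (1 + 1 / (2 * m₂)) * (1 + 1 / (2 * m₂)) := by
        gcongr
        exact min_le_left _ _
      rw [div_mul_cancel₀ _ (by positivity)] at e4
      linarith
    · have e1 : ‖m • fderiv ℝ H x₀‖ - ‖θ‖ ≤ ‖m • fderiv ℝ H x₀ - θ‖ := norm_sub_norm_le _ _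
      rw [hθ, norm_smul, Real.norm_eq_abs] at e1
      have e2 : |m| * m₁ ≤ |m| * ‖fderiv ℝ H x₀‖ := by gcongr
      have e3 : 2 ≤ |m| * m₁ := (div_le_iff₀ hm₁).1 hm
      have e4 : κ * (1 + |m|) ≤ m₁ / 2 / (1 + m₁ / 2) * (1 + |m|) := by
        gcongr
        exact min_le_right _ _
      have e5 : m₁ / 2 / (1 + m₁ / 2) * (1 + |m|) ≤ |m| * m₁ / 2 := by
        rw [div_mul_eq_mul_div, div_le_iff₀ (by positivity)]
        nlinarith
      linarith
  have hdir : ∀ i : ι, ∃ v, ‖v‖ ≤ 4 / κ ∧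
      2 * (1 + |i.1.1|) ≤ (i.1.1 • fderiv ℝ H x₀ - i.1.2) v := by
    intro i
    have hpos : 0 < 1 + |i.1.1| := by positivity
    have h1 : κ / 2 * (1 + |i.1.1|) < ‖i.1.1 • fderiv ℝ H x₀ - i.1.2‖ := by
      have := hlow i
      have : 0 < κ * (1 + |i.1.1|) := by positivity
      linarith
    obtain ⟨w, hw1, hw⟩ := ContinuousLinearMap.exists_lt_apply_of_lt_opNorm _ h1
    rw [Real.norm_eq_abs] at hw
    have key : ∀ w : V, ‖w‖ < 1 →
        κ / 2 * (1 + |i.1.1|) < (i.1.1 • fderiv ℝ H x₀ - i.1.2) w →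
        ∃ v, ‖v‖ ≤ 4 / κ ∧ 2 * (1 + |i.1.1|) ≤ (i.1.1 • fderiv ℝ H x₀ - i.1.2) v := by
      intro w hw1 hw
      refine ⟨(4 / κ) • w, ?_, ?_⟩
      · rw [norm_smul, Real.norm_of_nonneg (by positivity)]
        exact mul_le_of_le_one_right (by positivity) hw1.le
      · rw [map_smul, smul_eq_mul, div_mul_eq_mul_div, le_div_iff₀ hκ0]
        linarith
    rcases abs_cases ((i.1.1 • fderiv ℝ H x₀ - i.1.2) w) with ⟨h, _⟩ | ⟨h, _⟩
    · exact key w hw1 (h ▸ hw)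
    · exact key (-w) (by rwa [norm_neg]) (by rw [map_neg]; exact h ▸ hw)
  choose v hvV hv using hdir
  have hcont : ContinuousAt (fderiv ℝ H) x₀ := (hHs.continuous_fderiv (by simp)).continuousAt
  obtain ⟨r, hr, hball⟩ := Metric.continuousAt_iff.1 hcont (κ / 4) (by positivity)
  set Ψ : ι → V → ℝ := fun i x => (1 + |i.1.1|)⁻¹ * (i.1.1 * H x - i.1.2 x) with hΨ
  have hΨs : ∀ i, ContDiff ℝ ∞ (Ψ i) := fun i =>
    contDiff_const.mul ((contDiff_const.mul hHs).sub i.1.2.contDiff)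
  have hΨd : ∀ i x, fderiv ℝ (Ψ i) x
      = ((1 + |i.1.1|)⁻¹ * i.1.1) • fderiv ℝ H x + -((1 + |i.1.1|)⁻¹ • i.1.2) := by
    intro i x
    have h1 : HasFDerivAt H (fderiv ℝ H x) x := (hHs.differentiable (by simp) x).hasFDerivAt
    have h2 := ((h1.const_mul i.1.1).sub i.1.2.hasFDerivAt).const_mul (1 + |i.1.1|)⁻¹
    rw [show fderiv ℝ (Ψ i) x = _ from h2.fderiv]
    module
  have hD : UniformlySmooth fun i x => fderiv ℝ (Ψ i) x (v i) := by
    simp_rw [hΨd]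
    refine UniformlySmooth.clm_apply
      (f := fun (i : ι) x => ((1 + |i.1.1|)⁻¹ * i.1.1) • fderiv ℝ H x + -((1 + |i.1.1|)⁻¹ • i.1.2))
      ?_ hvV
    refine UniformlySmooth.add (UniformlySmooth.smul
      (UniformlySmooth.const (C := 1) (c := fun i : ι => (1 + |i.1.1|)⁻¹ * i.1.1) fun i => ?_)
      (UniformlySmooth.of_hasCompactSupport hHs hHc).fderiv)
      (UniformlySmooth.const (C := 1) fun i => ?_)
    · rw [norm_mul, norm_inv, Real.norm_of_nonneg (by positivity), inv_mul_le_iff₀ (by positivity),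
        Real.norm_eq_abs]
      linarith
    · rw [norm_neg, norm_smul, i.2.1, norm_inv, Real.norm_of_nonneg (by positivity), mul_one]
      exact inv_le_one_of_one_le₀ (by linarith [abs_nonneg i.1.1])
  refine ⟨min r 1, lt_min hr one_pos, fun b hb hbc hbs N => ?_⟩
  obtain ⟨C, hC⟩ := exists_pow_mul_norm_integral_exp_le μ hbc.isCompact hΨs hvV hD N
    (fun _ => b) (UniformlySmooth.of_hasCompactSupport hb hbc) (fun _ => subset_rfl) (by
      intro i x hx
      have hx' : dist (fderiv ℝ H x) (fderiv ℝ H x₀) < κ / 4 :=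
        hball (Metric.ball_subset_ball (min_le_left _ _) (hbs hx))
      rw [dist_eq_norm] at hx'
      have h3 := ((fderiv ℝ H x - fderiv ℝ H x₀).le_opNorm (v i)).trans
        (mul_le_mul hx'.le (hvV i) (norm_nonneg _) (by positivity))
      have h4 : κ / 4 * (4 / κ) = 1 := by field_simp
      rw [h4, Real.norm_eq_abs, _root_.sub_apply] at h3
      have h5 := hv i
      rw [_root_.sub_apply, _root_.smul_apply, smul_eq_mul] at h5
      have hpos : 0 < 1 + |i.1.1| := by positivity
      have h6 : fderiv ℝ (Ψ i) x (v i) = (1 + |i.1.1|)⁻¹ * (i.1.1 * fderiv ℝ H x (v i) - i.1.2 (v i)) := by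
        rw [hΨd]
        simp
        ring
      rw [h6, le_inv_mul_iff₀ hpos, mul_one]
      have h7 : |i.1.1 * (fderiv ℝ H x (v i) - fderiv ℝ H x₀ (v i))| ≤ |i.1.1| := by
        rw [abs_mul]
        exact mul_le_of_le_one_right (abs_nonneg _) h3
      have h8 := (abs_le.1 h7).1
      linarith)
  refine ⟨C, fun ξ m hξ hm => ?_⟩
  have hξ0 : 0 < ‖ξ‖ := norm_pos_iff.2 hξ
  have hpos : 0 < 1 + |m| := by positivity
  have h1 := hC ⟨(m, ‖ξ‖⁻¹ • ξ), by
    rw [norm_smul, norm_inv, norm_norm, inv_mul_cancel₀ hξ0.ne'], hm⟩ (‖ξ‖ * (1 + |m|)) (by positivity)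
  refine le_trans (le_of_eq ?_) h1
  congr 3
  ext x
  by_cases hx : x ∈ tsupport b
  · have hfx : f x = 1 := f.one_of_mem_closedBall
      (Metric.ball_subset_closedBall (Metric.ball_subset_ball (min_le_right _ _) (hbs hx)))
    congr 4
    simp only [hΨ, hH, hfx, _root_.smul_apply, smul_eq_mul]
    field_simp
  · simp [image_eq_zero_of_notMem_tsupport hx]

/-- Decay of `∫ a e^{i(λ m G - ξ)}`, `λ = ‖ξ‖`, for parameters `m` such that the phase has no
critical point on the support of the amplitude. -/
theorem exists_far_bound {G : V → ℝ} (hG : ContDiff ℝ ∞ G) {m₁ m₂ : ℝ} (hm₁ : 0 < m₁)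
    (hm₂ : 0 < m₂) {a : V → ℂ} (ha : ContDiff ℝ ∞ a) (hac : HasCompactSupport a)
    (h₁ : ∀ x ∈ tsupport a, m₁ ≤ ‖fderiv ℝ G x‖) (h₂ : ∀ x ∈ tsupport a, ‖fderiv ℝ G x‖ ≤ m₂)
    (N : ℕ) :
    ∃ C : ℝ, ∀ (ξ : V →L[ℝ] ℝ) (m : ℝ), ξ ≠ 0 → (|m| ≤ 1 / (2 * m₂) ∨ 2 / m₁ ≤ |m|) →
        (‖ξ‖ * (1 + |m|)) ^ N *
          ‖∫ x, a x * Complex.exp (Complex.I * (‖ξ‖ * (m * G x) - ξ x : ℝ)) ∂μ‖ ≤ C := by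
  refine smooth_localization (P := fun a => ∃ C : ℝ, ∀ (ξ : V →L[ℝ] ℝ) (m : ℝ), ξ ≠ 0 →
      (|m| ≤ 1 / (2 * m₂) ∨ 2 / m₁ ≤ |m|) → (‖ξ‖ * (1 + |m|)) ^ N *
          ‖∫ x, a x * Complex.exp (Complex.I * (‖ξ‖ * (m * G x) - ξ x : ℝ)) ∂μ‖ ≤ C)
    ⟨0, by simp⟩ ?_ ha hac fun z hz => ?_
  · rintro b c hb hbc hc hcc ⟨B, hB⟩ ⟨C, hC⟩
    refine ⟨B + C, fun ξ m hξ hm => ?_⟩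
    have hΨ : Continuous fun x => ‖ξ‖ * (m * G x) - ξ x := by
      have := hG.continuous
      fun_prop
    simp only [Pi.add_apply, add_mul]
    rw [integral_add (integrable_amplitude_mul_exp μ hb.continuous hbc hΨ)
      (integrable_amplitude_mul_exp μ hc.continuous hcc hΨ)]
    refine le_trans ?_ (add_le_add (hB ξ m hξ hm) (hC ξ m hξ hm))
    rw [← mul_add]
    gcongr
    exact norm_add_le _ _
  · obtain ⟨r, hr, h⟩ := exists_ball_far_bound μ hG hm₁ hm₂ (h₁ z hz) (h₂ z hz)
    exact ⟨r, hr, fun b hb hbc hbs => h b hb hbc hbs N⟩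

end Far

section Near

variable {V : Type*} [NormedAddCommGroup V] [NormedSpace ℝ V]

theorem hessian_mul_sub_one {G : V → ℝ} (hG : ContDiff ℝ ∞ G) (x v w : V) (m ν s : ℝ) :
    fderiv ℝ (fderiv ℝ fun p : V × ℝ => p.2 * (G p.1 - 1)) (x, m) (v, ν) (w, s)
      = m * fderiv ℝ (fderiv ℝ G) x v w + ν * fderiv ℝ G x w + s * fderiv ℝ G x v := by
  set φ : V × ℝ → ℝ := fun p => p.2 * (G p.1 - 1) with hφ
  have hφs : ContDiff ℝ ∞ φ := by fun_prop
  have hGd : ∀ p : V × ℝ, HasFDerivAt (fun p : V × ℝ => G p.1)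
      ((fderiv ℝ G p.1).comp (ContinuousLinearMap.fst ℝ V ℝ)) p := fun p =>
    ((hG.differentiable (by simp) p.1).hasFDerivAt).comp p hasFDerivAt_fst
  have h1 : ∀ p : V × ℝ, fderiv ℝ φ p (w, s) = p.2 * fderiv ℝ G p.1 w + (G p.1 - 1) * s := by
    intro p
    have := (hasFDerivAt_snd (𝕜 := ℝ) (p := p)).mul ((hGd p).sub_const 1)
    rw [show fderiv ℝ φ p = _ from this.fderiv]
    simp
  have h2 : HasFDerivAt (fun p => fderiv ℝ φ p (w, s))
      ((fderiv ℝ (fderiv ℝ φ) (x, m)).flip (w, s)) (x, m) := by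
    have h3 := ((hφs.fderiv_right (m := ∞) (by simp)).differentiable (by simp) (x, m)).hasFDerivAt
    simpa using h3.clm_apply (hasFDerivAt_const ((w, s) : V × ℝ) (x, m))
  have h4 : HasFDerivAt (fun p : V × ℝ => fderiv ℝ G p.1 w)
      (((fderiv ℝ (fderiv ℝ G) x).flip w).comp (ContinuousLinearMap.fst ℝ V ℝ)) (x, m) := by
    have h3 := ((hG.fderiv_right (m := ∞) (by simp)).differentiable (by simp) x).hasFDerivAt
    have h5 : HasFDerivAt (fun y => fderiv ℝ G y w) ((fderiv ℝ (fderiv ℝ G) x).flip w) x := by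
      simpa using h3.clm_apply (hasFDerivAt_const w x)
    exact HasFDerivAt.comp (f := Prod.fst) (x, m) h5 hasFDerivAt_fst
  have h6 := ((hasFDerivAt_snd (𝕜 := ℝ) (p := (x, m))).mul h4).add
    (((hGd (x, m)).sub_const 1).mul_const s)
  have h7 := h2.unique (h6.congr_of_eventuallyEq (Filter.Eventually.of_forall h1))
  have h8 := congrArg (fun L : V × ℝ →L[ℝ] ℝ => L (v, ν)) h7
  simp at h8
  rw [h8]
  ring

variable [FiniteDimensional ℝ V] [MeasurableSpace V] [BorelSpace V] (μ : Measure V)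
  [μ.IsAddHaarMeasure]

open Module in
theorem exists_near_bound {G : V → ℝ} (hG : ContDiff ℝ ∞ G) {a : V → ℂ} (ha : ContDiff ℝ ∞ a)
    (hac : HasCompactSupport a)
    (hnd : ∀ x ∈ tsupport a, ∀ m ν : ℝ, ∀ v, m ≠ 0 → fderiv ℝ G x v = 0 →
      (∀ w, m * fderiv ℝ (fderiv ℝ G) x v w + ν * fderiv ℝ G x w = 0) → v = 0 ∧ ν = 0)
    {η : ℝ → ℂ} (hη : ContDiff ℝ ∞ η) (hηc : HasCompactSupport η) (hη0 : (0 : ℝ) ∉ tsupport η) :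
    ∃ C : ℝ, ∀ t : ℝ, 0 < t → ∀ l : V × ℝ →L[ℝ] ℝ,
      ‖∫ p : V × ℝ, a p.1 * η p.2 *
          Complex.exp (Complex.I * (t * (p.2 * (G p.1 - 1)) + l p : ℝ)) ∂(μ.prod volume)‖
        ≤ C * t ^ (-((finrank ℝ V + 1) / 2 : ℝ)) := by
  have hφ : ContDiff ℝ ∞ fun p : V × ℝ => p.2 * (G p.1 - 1) := by fun_prop
  have hA : ContDiff ℝ ∞ fun p : V × ℝ => a p.1 * η p.2 := by fun_prop
  have hsub : tsupport (fun p : V × ℝ => a p.1 * η p.2) ⊆ tsupport a ×ˢ tsupport η := by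
    refine closure_minimal (fun p hp => ?_) ((isClosed_tsupport a).prod (isClosed_tsupport η))
    have hp' := mul_ne_zero_iff.1 (Function.mem_support.1 hp)
    exact ⟨subset_tsupport _ hp'.1, subset_tsupport _ hp'.2⟩
  have hAc : HasCompactSupport fun p : V × ℝ => a p.1 * η p.2 :=
    (hac.isCompact.prod hηc.isCompact).of_isClosed_subset (isClosed_tsupport _) hsub
  refine smooth_localization (P := fun b : V × ℝ → ℂ => ∃ C : ℝ, ∀ t : ℝ, 0 < t →
    ∀ l : V × ℝ →L[ℝ] ℝ, ‖∫ p : V × ℝ, b p *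
          Complex.exp (Complex.I * (t * (p.2 * (G p.1 - 1)) + l p : ℝ)) ∂(μ.prod volume)‖
        ≤ C * t ^ (-((finrank ℝ V + 1) / 2 : ℝ))) ⟨0, by simp⟩ ?_ hA hAc fun z hz => ?_
  · rintro b c hb hbc hc hcc ⟨B, hB⟩ ⟨C, hC⟩
    refine ⟨B + C, fun t ht l => ?_⟩
    have hΨ : Continuous fun p : V × ℝ => t * (p.2 * (G p.1 - 1)) + l p := by
      have := hφ.continuous
      fun_prop
    simp only [Pi.add_apply, add_mul]
    rw [integral_add (integrable_amplitude_mul_exp _ hb.continuous hbc hΨ)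
      (integrable_amplitude_mul_exp _ hc.continuous hcc hΨ)]
    exact norm_add_le_of_le (hB t ht l) (hC t ht l)
  · obtain ⟨hz1, hz2⟩ := hsub hz
    have hm : z.2 ≠ 0 := fun h => hη0 (h ▸ hz2)
    obtain ⟨r, hr, h⟩ := exists_ball_norm_integral_le (μ.prod volume) hφ (z₀ := z) (by
      rintro ⟨v, ν⟩ hu
      have hu' : ∀ w s, z.2 * fderiv ℝ (fderiv ℝ G) z.1 v w + ν * fderiv ℝ G z.1 w
          + s * fderiv ℝ G z.1 v = 0 := fun w s => by
        rw [← hessian_mul_sub_one hG]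
        exact hu (w, s)
      have h1 : fderiv ℝ G z.1 v = 0 := by simpa using hu' 0 1
      obtain ⟨h2, h3⟩ := hnd z.1 hz1 z.2 ν v hm h1 fun w => by simpa using hu' w 0
      rw [h2, h3]
      rfl)
    refine ⟨r, hr, fun b hb hbc hbs => ?_⟩
    obtain ⟨C, hC⟩ := h b hb hbs
    refine ⟨C, fun t ht l => ?_⟩
    have := hC t ht l
    rwa [finrank_prod, finrank_self, Nat.cast_add, Nat.cast_one] at this

end Near

open scoped FourierTransform Real in
open Complex in
/-- A smooth compactly supported function on the line is the Fourier transform of a function `w`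
that is integrable, bounded, and such that each `y ^ M * w y` is again a Fourier transform. -/
theorem exists_fourier_representation {ψ : ℝ → ℂ} (hψ : ContDiff ℝ ∞ ψ) (hc : HasCompactSupport ψ) :
    ∃ w : ℝ → ℂ, Continuous w ∧ Integrable w ∧ (∃ B, ∀ y, ‖w y‖ ≤ B) ∧
      (∀ s : ℝ, ψ s = ∫ y, w y * exp (I * (y * s : ℝ))) ∧
      ∀ M : ℕ, ∃ f : ℝ → ℂ, Integrable f ∧
        ∀ y : ℝ, (y : ℂ) ^ M * w y = ∫ s, f s * exp (-(I * (y * s : ℝ))) := by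
  let S : SchwartzMap ℝ ℂ := hc.toSchwartzMap hψ
  have hSψ : ∀ x, S x = ψ x := fun x => rfl
  have hπ : (2 * π : ℝ) ≠ 0 := by positivity
  refine ⟨fun y => (2 * π : ℝ)⁻¹ • (𝓕 S : SchwartzMap ℝ ℂ) (y / (2 * π)), ?_, ?_, ?_, ?_, ?_⟩
  · have := (𝓕 S : SchwartzMap ℝ ℂ).continuous.comp (continuous_id.div_const (2 * π))
    exact this.const_smul (2 * π : ℝ)⁻¹
  · exact (((𝓕 S : SchwartzMap ℝ ℂ).integrable (μ := volume)).comp_div hπ).smul (2 * π : ℝ)⁻¹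
  · obtain ⟨B, -, hB⟩ := (𝓕 S : SchwartzMap ℝ ℂ).decay 0 0
    refine ⟨‖(2 * π : ℝ)⁻¹‖ * B, fun y => ?_⟩
    rw [norm_smul]
    gcongr
    simpa using hB (y / (2 * π))
  · intro s
    obtain ⟨Φ, hΦ⟩ : ∃ Φ : ℝ → ℂ, ∀ u : ℝ, Φ u = (2 * π : ℝ)⁻¹ • ((𝓕 S : SchwartzMap ℝ ℂ) u *
        exp (I * (2 * π * u * s : ℝ))) := ⟨_, fun _ => rfl⟩
    have h1 : ∀ y : ℝ, (2 * π : ℝ)⁻¹ • (𝓕 S : SchwartzMap ℝ ℂ) (y / (2 * π)) * exp (I * (y * s : ℝ))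
        = Φ (y / (2 * π)) := by
      intro y
      rw [hΦ, smul_mul_assoc]
      congr 4
      field_simp
    rw [integral_congr_ae (Filter.Eventually.of_forall h1), Measure.integral_comp_div,
      integral_congr_ae (Filter.Eventually.of_forall hΦ), integral_smul,
      abs_of_pos (by positivity), smul_smul, mul_inv_cancel₀ hπ, one_smul, ← hSψ]
    have h2 : S = 𝓕⁻ (𝓕 S) := by simp
    conv_lhs => rw [h2]
    rw [SchwartzMap.fourierInv_coe, Real.fourierInv_eq']
    congr 1
    ext u
    rw [smul_eq_mul, mul_comm]
    congr 2
    simp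
    ring
  · intro M
    have hint : ∀ n : ℕ, Integrable (iteratedDeriv n ψ) := by
      intro n
      refine Continuous.integrable_of_hasCompactSupport
        (hψ.continuous_iteratedDeriv n (by exact_mod_cast le_top)) ?_
      have := hc.iteratedFDeriv (𝕜 := ℝ) n
      refine this.mono ?_
      intro x hx
      simp only [Function.mem_support, iteratedDeriv_eq_iteratedFDeriv] at hx ⊢
      intro h
      apply hx
      rw [h]
      rfl
    refine ⟨fun s => ((2 * π : ℝ)⁻¹ * (I ^ M)⁻¹) * iteratedDeriv M ψ s,
      (hint M).const_mul _, fun y => ?_⟩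
    have h3 := congrFun (Real.fourier_iteratedDeriv (N := ⊤) (n := M) hψ (fun n _ => hint n) le_top)
      (y / (2 * π))
    rw [Real.fourier_real_eq_integral_exp_smul] at h3
    have h4 : ∀ s : ℝ, (((2 * π : ℝ)⁻¹ * (I ^ M)⁻¹) * iteratedDeriv M ψ s) * exp (-(I * (y * s : ℝ)))
        = ((2 * π : ℝ)⁻¹ * (I ^ M)⁻¹ : ℂ) *
          (exp (((-2 * π * s * (y / (2 * π)) : ℝ) : ℂ) * I) • iteratedDeriv M ψ s) := by
      intro s
      rw [smul_eq_mul, mul_assoc]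
      congr 1
      rw [mul_comm]
      congr 2
      push_cast
      field_simp
    simp_rw [h4]
    rw [integral_const_mul, h3, SchwartzMap.fourier_coe]
    have h5 : (2 * π * I * ((y / (2 * π) : ℝ) : ℂ)) = I * y := by
      push_cast
      field_simp
    rw [h5, smul_eq_mul, mul_pow, real_smul]
    have : (I ^ M : ℂ) ≠ 0 := pow_ne_zero _ I_ne_zero
    have h6 : (S : ℝ → ℂ) = ψ := rfl
    rw [h6]
    push_cast
    field_simp

section Surface

variable {V : Type*} [NormedAddCommGroup V] [NormedSpace ℝ V] [FiniteDimensional ℝ V]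
  [MeasurableSpace V] [BorelSpace V] (μ : Measure V) [μ.IsAddHaarMeasure]

open Module in
theorem exists_near_part_bound {G : V → ℝ} (hG : ContDiff ℝ ∞ G) {a : V → ℂ} (ha : ContDiff ℝ ∞ a)
    (hac : HasCompactSupport a)
    (hnd : ∀ x ∈ tsupport a, ∀ m ν : ℝ, ∀ v, m ≠ 0 → fderiv ℝ G x v = 0 →
      (∀ w, m * fderiv ℝ (fderiv ℝ G) x v w + ν * fderiv ℝ G x w = 0) → v = 0 ∧ ν = 0)
    {η : ℝ → ℂ} (hη : ContDiff ℝ ∞ η) (hηc : HasCompactSupport η) (hη0 : (0 : ℝ) ∉ tsupport η)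
    {f u : ℝ → ℂ} (hf : Integrable f)
    (hu : ∀ y : ℝ, u y = ∫ s, f s * Complex.exp (-(Complex.I * (y * s : ℝ)))) :
    ∃ C : ℝ, ∀ κ t : ℝ, 0 < t → ∀ ξ : V →L[ℝ] ℝ,
      ‖∫ p : V × ℝ, a p.1 * η p.2 * u (κ * p.2) *
          Complex.exp (Complex.I * (t * (p.2 * (G p.1 - 1)) - ξ p.1 : ℝ)) ∂(μ.prod volume)‖
        ≤ C * t ^ (-((finrank ℝ V + 1) / 2 : ℝ)) := by
  obtain ⟨C, hC⟩ := exists_near_bound μ hG ha hac hnd hη hηc hη0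
  refine ⟨(∫ s, ‖f s‖) * C, fun κ t ht ξ => ?_⟩
  let l : ℝ → V × ℝ →L[ℝ] ℝ := fun s =>
    -(ξ.comp (ContinuousLinearMap.fst ℝ V ℝ)) - (κ * s) • ContinuousLinearMap.snd ℝ V ℝ
  have hGc := hG.continuous
  have hac' := ha.continuous
  have hηc' := hη.continuous
  have hAc : HasCompactSupport fun p : V × ℝ => a p.1 * η p.2 := by
    refine (hac.isCompact.prod hηc.isCompact).of_isClosed_subset (isClosed_tsupport _)
      (closure_minimal (fun p hp => ?_) ((isClosed_tsupport a).prod (isClosed_tsupport η)))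
    have hp' := mul_ne_zero_iff.1 (Function.mem_support.1 hp)
    exact ⟨subset_tsupport _ hp'.1, subset_tsupport _ hp'.2⟩
  have hAi := integrable_amplitude_mul_exp (μ.prod volume) (by fun_prop) hAc
    (Ψ := fun p : V × ℝ => t * (p.2 * (G p.1 - 1)) - ξ p.1) (by fun_prop)
  have hint : Integrable (Function.uncurry fun (p : V × ℝ) (s : ℝ) =>
      f s * (a p.1 * η p.2 * Complex.exp (Complex.I * (t * (p.2 * (G p.1 - 1)) + l s p : ℝ))))
      ((μ.prod volume).prod volume) := by
    refine ((hAi.mul_prod hf).bdd_mul (c := 1) (f := fun q : (V × ℝ) × ℝ =>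
      Complex.exp (Complex.I * (-(κ * q.2 * q.1.2) : ℝ))) ?_ ?_).congr ?_
    · exact Continuous.aestronglyMeasurable (by fun_prop)
    · exact Filter.Eventually.of_forall fun q => by rw [mul_comm, Complex.norm_exp_ofReal_mul_I]
    · refine Filter.Eventually.of_forall fun q => ?_
      have : Complex.exp (Complex.I * (t * (q.1.2 * (G q.1.1 - 1)) + l q.2 q.1 : ℝ)) =
          Complex.exp (Complex.I * (-(κ * q.2 * q.1.2) : ℝ)) *
            Complex.exp (Complex.I * (t * (q.1.2 * (G q.1.1 - 1)) - ξ q.1.1 : ℝ)) := by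
        rw [← Complex.exp_add]
        congr 1
        simp [l]
        ring
      simp only [Function.uncurry]
      rw [this]
      ring
  have h1 : ∀ p : V × ℝ, a p.1 * η p.2 * u (κ * p.2) *
      Complex.exp (Complex.I * (t * (p.2 * (G p.1 - 1)) - ξ p.1 : ℝ)) = ∫ s, f s *
      (a p.1 * η p.2 * Complex.exp (Complex.I * (t * (p.2 * (G p.1 - 1)) + l s p : ℝ))) := by
    intro p
    rw [hu, mul_assoc, mul_comm (∫ s, _), ← mul_assoc, ← integral_const_mul]
    congr 1
    ext s
    have : Complex.exp (Complex.I * (t * (p.2 * (G p.1 - 1)) + l s p : ℝ)) =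
        Complex.exp (-(Complex.I * (κ * p.2 * s : ℝ))) *
          Complex.exp (Complex.I * (t * (p.2 * (G p.1 - 1)) - ξ p.1 : ℝ)) := by
      rw [← Complex.exp_add]
      congr 1
      simp [l]
      ring
    rw [this]
    ring
  simp_rw [h1]
  rw [integral_integral_swap hint, mul_assoc, ← integral_mul_const]
  refine norm_integral_le_of_norm_le (hf.norm.mul_const _) (Filter.Eventually.of_forall fun s => ?_)
  rw [integral_const_mul, norm_mul]
  gcongr
  exact hC t ht (l s)

open Module in
/-- Decay of the Fourier transform of a thickened hypersurface measure on `{G = 1}`. -/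
theorem exists_surface_bound {G : V → ℝ} (hG : ContDiff ℝ ∞ G) {m₁ m₂ : ℝ} (hm₁ : 0 < m₁)
    (hm₂ : 0 < m₂) {a : V → ℂ} (ha : ContDiff ℝ ∞ a) (hac : HasCompactSupport a)
    (h₁ : ∀ x ∈ tsupport a, m₁ ≤ ‖fderiv ℝ G x‖) (h₂ : ∀ x ∈ tsupport a, ‖fderiv ℝ G x‖ ≤ m₂)
    (hnd : ∀ x ∈ tsupport a, ∀ m ν : ℝ, ∀ v, m ≠ 0 → fderiv ℝ G x v = 0 →
      (∀ w, m * fderiv ℝ (fderiv ℝ G) x v w + ν * fderiv ℝ G x w = 0) → v = 0 ∧ ν = 0)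
    {ψ : ℝ → ℂ} (hψ : ContDiff ℝ ∞ ψ) (hψc : HasCompactSupport ψ) (M : ℕ) :
    ∃ C : ℝ, ∀ δ : ℝ, 0 < δ → δ ≤ 1 → ∀ ξ : V →L[ℝ] ℝ, 1 ≤ ‖ξ‖ →
      (δ * ‖ξ‖) ^ M * ‖∫ x, (δ : ℂ)⁻¹ * ψ ((G x - 1) / δ) * a x *
        Complex.exp (-(Complex.I * (ξ x : ℝ))) ∂μ‖ ≤ C * ‖ξ‖ ^ (-((finrank ℝ V - 1) / 2 : ℝ)) := by
  obtain ⟨w, hwc, hwi, ⟨B, hB⟩, hw, hwM⟩ := exists_fourier_representation hψ hψc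
  obtain ⟨f, hf, hfM⟩ := hwM M
  set c : ℝ := 1 / (2 * m₂) with hc
  have hc0 : 0 < c := by positivity
  set K : ℝ := 2 / m₁ with hK
  have hK0 : 0 < K := by positivity
  let f₁ : ContDiffBump (0 : ℝ) := ⟨K, 2 * K, hK0, by linarith⟩
  let f₂ : ContDiffBump (0 : ℝ) := ⟨min (c / 2) K, c, by positivity, (min_le_left _ _).trans_lt (by linarith)⟩
  set η : ℝ → ℂ := fun m => ((f₁ m - f₂ m : ℝ) : ℂ) with hηdef
  have hη : ContDiff ℝ ∞ η := Complex.ofRealCLM.contDiff.comp (f₁.contDiff.sub f₂.contDiff)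
  have hηc : HasCompactSupport η :=
    (f₁.hasCompactSupport.sub f₂.hasCompactSupport).comp_left (g := fun r : ℝ => (r : ℂ)) rfl
  have hη0 : (0 : ℝ) ∉ tsupport η := by
    rw [notMem_tsupport_iff_eventuallyEq]
    filter_upwards [f₁.eventuallyEq_one, f₂.eventuallyEq_one] with x hx1 hx2
    simp [hηdef, hx1, hx2]
  have hη1 : ∀ m : ℝ, ‖1 - η m‖ ≤ 2 := by
    intro m
    rw [hηdef, ← Complex.ofReal_one, ← Complex.ofReal_sub, Complex.norm_real, Real.norm_eq_abs,
      abs_le]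
    have := f₁.nonneg (x := m)
    have := f₁.le_one (x := m)
    have := f₂.nonneg (x := m)
    have := f₂.le_one (x := m)
    constructor <;> linarith
  have hηfar : ∀ m : ℝ, 1 - η m ≠ 0 → |m| ≤ c ∨ K ≤ |m| := by
    intro m hm
    by_contra! hcon
    apply hm
    have e1 : f₁ m = 1 := f₁.one_of_mem_closedBall (by simpa using hcon.2.le)
    have e2 : f₂ m = 0 := f₂.zero_of_le_dist (by simpa using hcon.1.le)
    simp [hηdef, e1, e2]
  set ηM : ℝ → ℂ := fun m => η m * ((m : ℂ) ^ M)⁻¹ with hηM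
  have hηMs : ContDiff ℝ ∞ ηM := by
    rw [contDiff_iff_contDiffAt]
    intro m
    by_cases hm : m = 0
    · have : ηM =ᶠ[𝓝 m] fun _ => 0 := by
        rw [hm]
        filter_upwards [notMem_tsupport_iff_eventuallyEq.1 hη0] with s hs
        simp [hηM, hs]
      exact contDiffAt_const.congr_of_eventuallyEq this
    · refine hη.contDiffAt.mul (ContDiffAt.inv ?_ (pow_ne_zero _ (by exact_mod_cast hm)))
      exact (Complex.ofRealCLM.contDiff.pow M).contDiffAt
  have hηMc : HasCompactSupport ηM := hηc.mul_right
  have hηM0 : (0 : ℝ) ∉ tsupport ηM := by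
    rw [notMem_tsupport_iff_eventuallyEq] at hη0 ⊢
    filter_upwards [hη0] with s hs
    simp [hηM, hs]
  obtain ⟨C₁, hC₁⟩ := exists_near_part_bound μ hG ha hac hnd hηMs hηMc hηM0 hf hfM
  set N : ℕ := M + finrank ℝ V + 2 with hN
  obtain ⟨C₂, hC₂⟩ := exists_far_bound μ hG hm₁ hm₂ ha hac h₁ h₂ N
  set D : ℝ := ∫ m : ℝ, (1 + ‖m‖) ^ (-2 : ℝ) with hD
  have hDi : Integrable fun m : ℝ => (1 + ‖m‖) ^ (-2 : ℝ) :=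
    integrable_one_add_norm (by norm_num)
  have hGc := hG.continuous
  have hac' := ha.continuous
  have hηc' := hη.continuous
  refine ⟨C₁ + |B| * 2 * |C₂| * D, fun δ hδ hδ1 ξ hξ => ?_⟩
  set lam : ℝ := ‖ξ‖ with hlam
  have hlam0 : 0 < lam := by linarith
  set κ : ℝ := δ * lam with hκ
  have hκ0 : 0 < κ := by positivity
  have hAi : Integrable (fun p : V × ℝ => a p.1 * w (κ * p.2) *
      Complex.exp (Complex.I * (lam * (p.2 * (G p.1 - 1)) - ξ p.1 : ℝ))) (μ.prod volume) := by
    refine Integrable.mul_bdd (c := 1) ((ha.continuous.integrable_of_hasCompactSupport hac).mul_prod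
      (hwi.comp_mul_left' hκ0.ne')) ?_ ?_
    · exact Continuous.aestronglyMeasurable (by fun_prop)
    · exact Filter.Eventually.of_forall fun q => by rw [mul_comm, Complex.norm_exp_ofReal_mul_I]
  have hAη : ∀ {ζ : ℝ → ℂ} {b : ℝ}, Continuous ζ → (∀ m, ‖ζ m‖ ≤ b) →
      Integrable (fun p : V × ℝ => ζ p.2 * (a p.1 * w (κ * p.2) *
      Complex.exp (Complex.I * (lam * (p.2 * (G p.1 - 1)) - ξ p.1 : ℝ)))) (μ.prod volume) := by
    intro ζ b hζ hb
    refine hAi.bdd_mul (c := b) (Continuous.aestronglyMeasurable (by fun_prop))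
      (Filter.Eventually.of_forall fun q => hb _)
  have hrep : ∫ x, (δ : ℂ)⁻¹ * ψ ((G x - 1) / δ) * a x * Complex.exp (-(Complex.I * (ξ x : ℝ))) ∂μ
      = lam * ∫ p : V × ℝ, a p.1 * w (κ * p.2) *
      Complex.exp (Complex.I * (lam * (p.2 * (G p.1 - 1)) - ξ p.1 : ℝ)) ∂(μ.prod volume) := by
    rw [integral_prod _ hAi, ← integral_const_mul]
    congr 1
    ext x
    have e1 : ∀ m : ℝ, a x * w (κ * m) * Complex.exp (Complex.I * (lam * (m * (G x - 1)) - ξ x : ℝ))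
        = (a x * Complex.exp (-(Complex.I * (ξ x : ℝ)))) * (fun y : ℝ => w y *
          Complex.exp (Complex.I * (y * ((G x - 1) / δ) : ℝ))) (κ * m) := by
      intro m
      have : Complex.exp (Complex.I * (lam * (m * (G x - 1)) - ξ x : ℝ)) =
          Complex.exp (-(Complex.I * (ξ x : ℝ))) *
            Complex.exp (Complex.I * (κ * m * ((G x - 1) / δ) : ℝ)) := by
        rw [← Complex.exp_add]
        congr 1
        rw [hκ]
        push_cast
        have : (δ : ℂ) ≠ 0 := by exact_mod_cast hδ.ne'
        field_simp
        ring
      rw [this]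
      ring
    rw [integral_congr_ae (Filter.Eventually.of_forall e1), integral_const_mul,
      Measure.integral_comp_mul_left (fun y : ℝ => w y *
          Complex.exp (Complex.I * (y * ((G x - 1) / δ) : ℝ))) κ, ← hw, abs_of_pos (by positivity),
      hκ, Complex.real_smul]
    have : (δ : ℂ) ≠ 0 := by exact_mod_cast hδ.ne'
    have : (lam : ℂ) ≠ 0 := by exact_mod_cast hlam0.ne'
    push_cast
    field_simp
  have hsplit : ∫ p : V × ℝ, a p.1 * w (κ * p.2) *
      Complex.exp (Complex.I * (lam * (p.2 * (G p.1 - 1)) - ξ p.1 : ℝ)) ∂(μ.prod volume)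
      = (∫ p : V × ℝ, η p.2 * (a p.1 * w (κ * p.2) *
      Complex.exp (Complex.I * (lam * (p.2 * (G p.1 - 1)) - ξ p.1 : ℝ))) ∂(μ.prod volume))
      + ∫ p : V × ℝ, (1 - η p.2) * (a p.1 * w (κ * p.2) *
      Complex.exp (Complex.I * (lam * (p.2 * (G p.1 - 1)) - ξ p.1 : ℝ))) ∂(μ.prod volume) := by
    obtain ⟨b, hb⟩ := hηc.exists_bound_of_continuous hηc'
    rw [← integral_add (hAη hηc' hb) (hAη (ζ := fun m => 1 - η m) (by fun_prop) hη1)]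
    congr 1
    ext p
    ring
  have hnear : κ ^ M * ‖∫ p : V × ℝ, η p.2 * (a p.1 * w (κ * p.2) *
      Complex.exp (Complex.I * (lam * (p.2 * (G p.1 - 1)) - ξ p.1 : ℝ))) ∂(μ.prod volume)‖
      ≤ C₁ * lam ^ (-((finrank ℝ V + 1) / 2 : ℝ)) := by
    refine le_trans (le_of_eq ?_) (hC₁ κ lam hlam0 ξ)
    rw [← Real.norm_of_nonneg (pow_nonneg hκ0.le M), ← Complex.norm_real, ← norm_mul,
      ← integral_const_mul]
    congr 2
    ext p
    by_cases hp : p.2 = 0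
    · have : η p.2 = 0 := by
        rw [hp]; exact image_eq_zero_of_notMem_tsupport hη0
      simp [hηM, this]
    · have hp' : (p.2 : ℂ) ≠ 0 := by exact_mod_cast hp
      simp only [hηM]
      push_cast
      rw [mul_pow]
      field_simp
  have hfar : κ ^ M * ‖∫ p : V × ℝ, (1 - η p.2) * (a p.1 * w (κ * p.2) *
      Complex.exp (Complex.I * (lam * (p.2 * (G p.1 - 1)) - ξ p.1 : ℝ))) ∂(μ.prod volume)‖
      ≤ |B| * 2 * |C₂| * D * lam ^ (-((finrank ℝ V + 1) / 2 : ℝ)) := by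
    rw [integral_prod_symm _ (hAη (ζ := fun m => 1 - η m) (by fun_prop) hη1)]
    have e0 : κ ^ M * (lam ^ N)⁻¹ ≤ lam ^ (-((finrank ℝ V + 1) / 2 : ℝ)) := by
      have e1 : κ ^ M ≤ lam ^ M := by
        gcongr
        exact mul_le_of_le_one_left hlam0.le hδ1
      calc κ ^ M * (lam ^ N)⁻¹ ≤ lam ^ M * (lam ^ N)⁻¹ := by gcongr
        _ = lam ^ (-((finrank ℝ V : ℝ) + 2)) := by
          rw [← Real.rpow_natCast, ← Real.rpow_natCast, ← Real.rpow_neg hlam0.le,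
            ← Real.rpow_add hlam0, hN]
          push_cast
          ring_nf
        _ ≤ _ := by
          apply Real.rpow_le_rpow_of_exponent_le hξ
          have : (0 : ℝ) ≤ finrank ℝ V := by positivity
          linarith
    have e2 : ∀ m : ℝ, ‖∫ x, (1 - η m) * (a x * w (κ * m) *
        Complex.exp (Complex.I * (lam * (m * (G x - 1)) - ξ x : ℝ))) ∂μ‖
        ≤ |B| * 2 * (|C₂| * (lam ^ N)⁻¹) * (1 + ‖m‖) ^ (-2 : ℝ) := by
      intro m
      by_cases hm : 1 - η m = 0
      · simp only [hm, zero_mul, integral_zero, norm_zero]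
        positivity
      have e3 : ∀ x, (1 - η m) * (a x * w (κ * m) *
          Complex.exp (Complex.I * (lam * (m * (G x - 1)) - ξ x : ℝ)))
          = ((1 - η m) * w (κ * m) * Complex.exp ((-(lam * m) : ℝ) * Complex.I)) *
            (a x * Complex.exp (Complex.I * (lam * (m * G x) - ξ x : ℝ))) := by
        intro x
        have : Complex.exp (Complex.I * (lam * (m * (G x - 1)) - ξ x : ℝ)) =
          Complex.exp ((-(lam * m) : ℝ) * Complex.I) *
            Complex.exp (Complex.I * (lam * (m * G x) - ξ x : ℝ)) := by
          rw [← Complex.exp_add]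
          congr 1
          push_cast
          ring
        rw [this]
        ring
      rw [integral_congr_ae (Filter.Eventually.of_forall e3), integral_const_mul, norm_mul,
        norm_mul, norm_mul, Complex.norm_exp_ofReal_mul_I, mul_one]
      have e4 := hC₂ ξ m (norm_pos_iff.1 hlam0) (hηfar m hm)
      have hpos : 0 < 1 + |m| := by positivity
      have e5 : ‖∫ x, a x * Complex.exp (Complex.I * (lam * (m * G x) - ξ x : ℝ)) ∂μ‖
          ≤ |C₂| * (lam ^ N)⁻¹ * (1 + ‖m‖) ^ (-2 : ℝ) := by
        rw [mul_comm, ← le_div_iff₀ (by positivity)] at e4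
        refine e4.trans ?_
        rw [mul_pow, div_eq_mul_inv, mul_inv, ← mul_assoc]
        have e6 : ((1 + |m|) ^ N)⁻¹ ≤ (1 + ‖m‖) ^ (-2 : ℝ) := by
          rw [Real.norm_eq_abs, Real.rpow_neg hpos.le]
          gcongr
          rw [show (2 : ℝ) = ((2 : ℕ) : ℝ) by norm_num, Real.rpow_natCast]
          exact pow_le_pow_right₀ (by linarith [abs_nonneg m]) (by omega)
        gcongr
        exact le_abs_self _
      calc _ ≤ 2 * |B| * (|C₂| * (lam ^ N)⁻¹ * (1 + ‖m‖) ^ (-2 : ℝ)) := by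
            gcongr
            · exact hη1 m
            · exact (hB _).trans (le_abs_self _)
        _ = _ := by ring
    calc _ ≤ κ ^ M * (|B| * 2 * (|C₂| * (lam ^ N)⁻¹) * D) := by
          gcongr
          rw [hD, ← integral_const_mul]
          exact norm_integral_le_of_norm_le (hDi.const_mul _) (Filter.Eventually.of_forall e2)
      _ = |B| * 2 * |C₂| * D * (κ ^ M * (lam ^ N)⁻¹) := by ring
      _ ≤ _ := by
          have : 0 ≤ D := integral_nonneg fun m => by positivity
          gcongr
  rw [hrep, hsplit, norm_mul, Complex.norm_real, Real.norm_of_nonneg hlam0.le]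
  calc _ ≤ lam * (C₁ * lam ^ (-((finrank ℝ V + 1) / 2 : ℝ)) +
        |B| * 2 * |C₂| * D * lam ^ (-((finrank ℝ V + 1) / 2 : ℝ))) := by
        rw [← mul_assoc, mul_comm (κ ^ M), mul_assoc]
        gcongr
        refine le_trans ?_ (add_le_add hnear hfar)
        rw [← mul_add]
        gcongr
        exact norm_add_le _ _
    _ = (C₁ + |B| * 2 * |C₂| * D) * (lam ^ (1 : ℝ) * lam ^ (-((finrank ℝ V + 1) / 2 : ℝ))) := by
        rw [Real.rpow_one]
        ring
    _ = _ := by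
        rw [← Real.rpow_add hlam0]
        ring_nf

end Surface

open Module in
theorem exists_surface_bound_one_add {V : Type*} [NormedAddCommGroup V] [NormedSpace ℝ V]
    [FiniteDimensional ℝ V] [MeasurableSpace V] [BorelSpace V] (μ : Measure V) [μ.IsAddHaarMeasure]
    {G : V → ℝ} (hG : ContDiff ℝ ∞ G) {a : V → ℂ} (ha : ContDiff ℝ ∞ a) (hac : HasCompactSupport a)
    (h₀ : ∀ x ∈ tsupport a, fderiv ℝ G x ≠ 0)
    (hnd : ∀ x ∈ tsupport a, ∀ m ν : ℝ, ∀ v, m ≠ 0 → fderiv ℝ G x v = 0 →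
      (∀ w, m * fderiv ℝ (fderiv ℝ G) x v w + ν * fderiv ℝ G x w = 0) → v = 0 ∧ ν = 0)
    {ψ : ℝ → ℂ} (hψ : ContDiff ℝ ∞ ψ) (hψc : HasCompactSupport ψ) (M : ℕ) :
    ∃ C : ℝ, ∀ δ : ℝ, 0 < δ → δ ≤ 1 → ∀ ξ : V →L[ℝ] ℝ, 1 ≤ ‖ξ‖ →
      (1 + δ * ‖ξ‖) ^ M * ‖∫ x, (δ : ℂ)⁻¹ * ψ ((G x - 1) / δ) * a x *
        Complex.exp (-(Complex.I * (ξ x : ℝ))) ∂μ‖ ≤ C * ‖ξ‖ ^ (-((finrank ℝ V - 1) / 2 : ℝ)) := by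
  have hcont : Continuous fun x => ‖fderiv ℝ G x‖ := (hG.continuous_fderiv (by simp)).norm
  obtain ⟨m₁, hm₁, h₁⟩ : ∃ m₁ > 0, ∀ x ∈ tsupport a, m₁ ≤ ‖fderiv ℝ G x‖ := by
    rcases (tsupport a).eq_empty_or_nonempty with h | h
    · exact ⟨1, one_pos, by simp [h]⟩
    · obtain ⟨x₀, hx₀, hmin⟩ := hac.isCompact.exists_isMinOn h hcont.continuousOn
      exact ⟨_, norm_pos_iff.2 (h₀ x₀ hx₀), fun x hx => hmin hx⟩
  obtain ⟨m₂, h₂⟩ := hac.isCompact.exists_bound_of_continuousOn hcont.continuousOn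
  obtain ⟨C₀, hC₀⟩ := exists_surface_bound μ hG hm₁ (lt_max_of_lt_right one_pos : 0 < max m₂ 1)
    ha hac h₁ (fun x hx => (by simpa using h₂ x hx : _ ≤ m₂).trans (le_max_left _ _)) hnd hψ hψc 0
  obtain ⟨C₁, hC₁⟩ := exists_surface_bound μ hG hm₁ (lt_max_of_lt_right one_pos : 0 < max m₂ 1)
    ha hac h₁ (fun x hx => (by simpa using h₂ x hx : _ ≤ m₂).trans (le_max_left _ _)) hnd hψ hψc M
  refine ⟨2 ^ (M - 1) * (C₀ + C₁), fun δ hδ hδ1 ξ hξ => ?_⟩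
  have e0 := hC₀ δ hδ hδ1 ξ hξ
  have e1 := hC₁ δ hδ hδ1 ξ hξ
  rw [pow_zero, one_mul] at e0
  have e2 : (1 + δ * ‖ξ‖) ^ M ≤ 2 ^ (M - 1) * (1 ^ M + (δ * ‖ξ‖) ^ M) :=
    _root_.add_pow_le zero_le_one (by positivity) M
  calc _ ≤ 2 ^ (M - 1) * (1 ^ M + (δ * ‖ξ‖) ^ M) * ‖∫ x, (δ : ℂ)⁻¹ * ψ ((G x - 1) / δ) * a x *
        Complex.exp (-(Complex.I * (ξ x : ℝ))) ∂μ‖ := by gcongr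
    _ = 2 ^ (M - 1) * (‖∫ x, (δ : ℂ)⁻¹ * ψ ((G x - 1) / δ) * a x *
        Complex.exp (-(Complex.I * (ξ x : ℝ))) ∂μ‖ + (δ * ‖ξ‖) ^ M *
        ‖∫ x, (δ : ℂ)⁻¹ * ψ ((G x - 1) / δ) * a x *
        Complex.exp (-(Complex.I * (ξ x : ℝ))) ∂μ‖) := by
        rw [one_pow]; ring
    _ ≤ 2 ^ (M - 1) * (C₀ * ‖ξ‖ ^ (-((finrank ℝ V - 1) / 2 : ℝ)) +
          C₁ * ‖ξ‖ ^ (-((finrank ℝ V - 1) / 2 : ℝ))) := by gcongr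
    _ = _ := by ring

/-- Integration by parts against a character. -/
theorem apply_mul_integral_mul_exp {V : Type*} [NormedAddCommGroup V] [NormedSpace ℝ V]
    [FiniteDimensional ℝ V] [MeasurableSpace V] [BorelSpace V] (μ : Measure V) [μ.IsAddHaarMeasure]
    {F : V → ℂ} (hF : ContDiff ℝ 1 F) (hFc : HasCompactSupport F) (ξ : V →L[ℝ] ℝ) (v : V) :
    Complex.I * ξ v * ∫ x, F x * Complex.exp (-(Complex.I * (ξ x : ℝ))) ∂μ
      = ∫ x, fderiv ℝ F x v * Complex.exp (-(Complex.I * (ξ x : ℝ))) ∂μ := by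
  set e : V → ℂ := fun x => Complex.exp (-(Complex.I * (ξ x : ℝ))) with he
  have hd : ∀ x, HasFDerivAt e (e x • (-(Complex.I • Complex.ofRealCLM.comp ξ))) x := fun x =>
    ((((Complex.ofRealCLM.comp ξ).hasFDerivAt (x := x)).const_smul Complex.I).neg).cexp
  have hec : Continuous e := by fun_prop
  have hF' : Continuous fun x => fderiv ℝ F x v :=
    (hF.continuous_fderiv one_ne_zero).clm_apply continuous_const
  have h1 : ∀ x, fderiv ℝ e x v = -(Complex.I * ξ v) * e x := by
    intro x
    rw [(hd x).fderiv]
    simp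
    ring
  have h2 := integral_mul_fderiv_eq_neg_fderiv_mul_of_integrable (μ := μ) (f := F) (g := e) (v := v)
    ((hF'.mul hec).integrable_of_hasCompactSupport ((hFc.fderiv_apply (𝕜 := ℝ) v).mul_right))
    (by
      simp_rw [h1]
      exact (hF.continuous.mul (continuous_const.mul hec)).integrable_of_hasCompactSupport
        hFc.mul_right)
    ((hF.continuous.mul hec).integrable_of_hasCompactSupport hFc.mul_right)
    (fun x _ => hF.differentiable one_ne_zero x) (fun x _ => (hd x).differentiableAt)
  have h3 : ∀ x, F x * fderiv ℝ e x v = -(Complex.I * ξ v) * (F x * e x) := fun x => by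
    rw [h1]; ring
  rw [integral_congr_ae (Filter.Eventually.of_forall h3), integral_const_mul] at h2
  rw [← neg_inj, ← h2]
  ring

/-- Fourier decay of the mollified indicator `H ((G - 1) / δ)` of the body `{G < 1}`. -/
theorem exists_fourier_bound {n : ℕ} {G : (Fin n → ℝ) → ℝ} (hG : ContDiff ℝ ∞ G)
    (hGc : IsCompact {x | G x ≤ 3 / 2})
    (h₀ : ∀ x, 1 / 2 ≤ G x → G x ≤ 3 / 2 → fderiv ℝ G x ≠ 0)
    (hnd : ∀ x, 1 / 2 ≤ G x → G x ≤ 3 / 2 → ∀ m ν : ℝ, ∀ v, m ≠ 0 → fderiv ℝ G x v = 0 →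
      (∀ w, m * fderiv ℝ (fderiv ℝ G) x v w + ν * fderiv ℝ G x w = 0) → v = 0 ∧ ν = 0)
    {H : ℝ → ℝ} (hH : ContDiff ℝ ∞ H) (hH1 : ∀ s ≤ -1, H s = 1) (hH0 : ∀ s, 1 ≤ s → H s = 0)
    (M : ℕ) :
    ∃ C : ℝ, ∀ δ : ℝ, 0 < δ → δ ≤ 1 / 4 → ∀ ξ : (Fin n → ℝ) →L[ℝ] ℝ, 1 ≤ ‖ξ‖ →
      (1 + δ * ‖ξ‖) ^ M * ‖∫ x, (H ((G x - 1) / δ) : ℂ) *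
        Complex.exp (-(Complex.I * (ξ x : ℝ)))‖ ≤ C * ‖ξ‖ ^ (-((n + 1) / 2 : ℝ)) := by
  set ψ : ℝ → ℂ := fun s => (deriv H s : ℝ) with hψdef
  have hH' : ContDiff ℝ ∞ (deriv H) := (contDiff_infty_iff_deriv.1 hH).2
  have hψ : ContDiff ℝ ∞ ψ := Complex.ofRealCLM.contDiff.comp hH'
  have hψ0 : ∀ s, 1 < |s| → deriv H s = 0 := by
    intro s hs
    rcases lt_abs.1 hs with h | h
    · have : H =ᶠ[𝓝 s] fun _ => 0 := by
        filter_upwards [lt_mem_nhds h] with y hy using hH0 y hy.le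
      rw [this.deriv_eq]
      simp
    · have : H =ᶠ[𝓝 s] fun _ => 1 := by
        filter_upwards [gt_mem_nhds (show s < -1 by linarith)] with y hy using hH1 y hy.le
      rw [this.deriv_eq]
      simp
  have hψc : HasCompactSupport ψ := by
    refine HasCompactSupport.intro (isCompact_Icc (a := (-1 : ℝ)) (b := 1)) fun s hs => ?_
    have : 1 < |s| := by
      by_contra! h
      exact hs (abs_le.1 h)
    simp [hψdef, hψ0 s this]
  let h : ContDiffBump (1 : ℝ) := ⟨1 / 4, 1 / 2, by norm_num, by norm_num⟩
  let a : Fin n → (Fin n → ℝ) → ℂ := fun j x => ((h (G x) * fderiv ℝ G x (Pi.single j 1) : ℝ) : ℂ)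
  have ha : ∀ j, ContDiff ℝ ∞ (a j) := fun j => Complex.ofRealCLM.contDiff.comp
    ((h.contDiff.comp hG).mul ((hG.fderiv_right (m := ∞) (by simp)).clm_apply contDiff_const))
  have hS : IsClosed {x | 1 / 2 ≤ G x ∧ G x ≤ 3 / 2} :=
    (isClosed_le continuous_const hG.continuous).inter (isClosed_le hG.continuous continuous_const)
  have hsub : ∀ j, tsupport (a j) ⊆ {x | 1 / 2 ≤ G x ∧ G x ≤ 3 / 2} := by
    refine fun j => closure_minimal (fun x hx => ?_) hS
    have h1 : h (G x) ≠ 0 := fun h0 => hx (by simp [a, h0])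
    have h2 : G x ∈ Metric.ball (1 : ℝ) (1 / 2) := by
      rw [← h.support_eq]
      exact h1
    rw [Metric.mem_ball, Real.dist_eq, abs_lt] at h2
    constructor <;> linarith [h2.1, h2.2]
  have hac : ∀ j, HasCompactSupport (a j) := fun j =>
    hGc.of_isClosed_subset (isClosed_tsupport _) fun x hx => (hsub j hx).2
  choose C hC using fun j => exists_surface_bound_one_add volume hG (ha j) (hac j)
    (fun x hx => h₀ x (hsub j hx).1 (hsub j hx).2)
    (fun x hx => hnd x (hsub j hx).1 (hsub j hx).2) hψ hψc M
  refine ⟨∑ j, C j, fun δ hδ hδ1 ξ hξ => ?_⟩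
  set F : (Fin n → ℝ) → ℂ := fun x => (H ((G x - 1) / δ) : ℂ) with hF
  have hFs : ContDiff ℝ ∞ F :=
    Complex.ofRealCLM.contDiff.comp (hH.comp ((hG.sub contDiff_const).div_const δ))
  have hFc : HasCompactSupport F := by
    refine HasCompactSupport.intro hGc fun x hx => ?_
    simp only [Set.mem_ofPred_eq, not_le] at hx
    have : H ((G x - 1) / δ) = 0 := hH0 _ (by rw [le_div_iff₀ hδ]; linarith)
    simp [hF, this]
  have hF' : ∀ j x, fderiv ℝ F x (Pi.single j 1) = (δ : ℂ)⁻¹ * ψ ((G x - 1) / δ) * a j x := by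
    intro j x
    have e1 : HasFDerivAt (fun x => (G x - 1) * δ⁻¹) _ x :=
      (((hG.differentiable (by simp) x).hasFDerivAt).sub_const 1).mul_const δ⁻¹
    have e2 := Complex.ofRealCLM.hasFDerivAt.comp x
      (((hH.differentiable (by simp) ((G x - 1) * δ⁻¹)).hasDerivAt).comp_hasFDerivAt x e1)
    have e3 : fderiv ℝ F x (Pi.single j 1)
        = ((deriv H ((G x - 1) / δ) * (δ⁻¹ * fderiv ℝ G x (Pi.single j 1)) : ℝ) : ℂ) := by
      rw [show fderiv ℝ F x = _ from e2.fderiv]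
      simp [div_eq_mul_inv]
    rw [e3]
    by_cases h1 : 1 < |(G x - 1) / δ|
    · simp [hψdef, hψ0 _ h1]
    · have h2 : h (G x) = 1 := by
        refine h.one_of_mem_closedBall ?_
        rw [Metric.mem_closedBall, Real.dist_eq]
        rw [abs_div, abs_of_pos hδ, not_lt, div_le_one hδ] at h1
        exact h1.trans hδ1
      simp only [a, h2, hψdef]
      push_cast
      ring
  have hpart : ∀ j, |ξ (Pi.single j 1)| * ‖∫ x, F x * Complex.exp (-(Complex.I * (ξ x : ℝ)))‖
      = ‖∫ x, (δ : ℂ)⁻¹ * ψ ((G x - 1) / δ) * a j x * Complex.exp (-(Complex.I * (ξ x : ℝ)))‖ := by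
    intro j
    have := apply_mul_integral_mul_exp volume (hFs.of_le (by simp)) hFc ξ (Pi.single j 1)
    simp_rw [hF'] at this
    rw [← this, norm_mul, norm_mul, Complex.norm_I, one_mul, Complex.norm_real, Real.norm_eq_abs]
  have hnorm : ‖ξ‖ ≤ ∑ j, |ξ (Pi.single j 1)| := by
    refine ContinuousLinearMap.opNorm_le_bound _ (Finset.sum_nonneg fun _ _ => abs_nonneg _)
      fun x => ?_
    have hx : ξ x = ∑ j, x j * ξ (Pi.single j 1) := by
      conv_lhs => rw [pi_eq_sum_univ' x, map_sum]
      simp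
    rw [hx, Finset.sum_mul]
    refine norm_sum_le_of_le _ fun j _ => ?_
    rw [norm_mul, mul_comm]
    exact mul_le_mul_of_nonneg_left (norm_le_pi_norm x j) (abs_nonneg _)
  have hξ0 : 0 < ‖ξ‖ := by linarith
  have hrp : ‖ξ‖ ^ (-((n + 1) / 2 : ℝ)) = ‖ξ‖⁻¹ * ‖ξ‖ ^ (-((n - 1) / 2 : ℝ)) := by
    rw [← Real.rpow_neg_one, ← Real.rpow_add hξ0]
    ring_nf
  rw [hrp, ← mul_assoc, mul_comm _ ‖ξ‖⁻¹, mul_assoc, ← div_eq_inv_mul, le_div_iff₀ hξ0]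
  calc _ = (1 + δ * ‖ξ‖) ^ M * ‖∫ x, F x * Complex.exp (-(Complex.I * (ξ x : ℝ)))‖ * ‖ξ‖ := rfl
    _ ≤ (1 + δ * ‖ξ‖) ^ M * ‖∫ x, F x * Complex.exp (-(Complex.I * (ξ x : ℝ)))‖ *
        ∑ j, |ξ (Pi.single j 1)| := by gcongr
    _ = ∑ j, (1 + δ * ‖ξ‖) ^ M * (|ξ (Pi.single j 1)| *
          ‖∫ x, F x * Complex.exp (-(Complex.I * (ξ x : ℝ)))‖) := by
        rw [Finset.mul_sum]
        exact Finset.sum_congr rfl fun j _ => by ring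
    _ ≤ ∑ j, C j * ‖ξ‖ ^ (-((n - 1) / 2 : ℝ)) := by
        refine Finset.sum_le_sum fun j _ => ?_
        rw [hpart]
        simpa using hC j δ hδ (by linarith) ξ hξ
    _ = _ := by rw [Finset.sum_mul]

theorem finite_setOf_norm_intCast_le (n : ℕ) (B : ℝ) :
    {k : Fin n → ℤ | ‖(fun i => (k i : ℝ))‖ ≤ B}.Finite := by
  refine (Set.finite_Icc (fun _ : Fin n => -⌈B⌉) (fun _ => ⌈B⌉)).subset fun k hk => ?_
  have h : ∀ i, |(k i : ℝ)| ≤ ⌈B⌉ := fun i =>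
    ((norm_le_pi_norm (fun i => (k i : ℝ)) i).trans hk).trans (Int.le_ceil B)
  refine ⟨fun i => ?_, fun i => ?_⟩
  · exact_mod_cast (abs_le.1 (h i)).1
  · exact_mod_cast (abs_le.1 (h i)).2

theorem HasCompactSupport.exists_norm_bound {n : ℕ} {F : (Fin n → ℝ) → ℂ}
    (hc : HasCompactSupport F) : ∃ R : ℝ, ∀ x, F x ≠ 0 → ‖x‖ ≤ R := by
  obtain ⟨R, hR⟩ := hc.isCompact.isBounded.subset_closedBall 0
  exact ⟨R, fun x hx => by simpa using hR (subset_tsupport F hx)⟩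

/-- The half-open unit cube with lower corner at the integer point `k`. -/
def integerCube {n : ℕ} (k : Fin n → ℤ) : Set (Fin n → ℝ) :=
  (fun x => x - fun i => (k i : ℝ)) ⁻¹' {x | ∀ i, x i ∈ Set.Ioc (0 : ℝ) (0 + 1)}

theorem measurableSet_setOf_forall_mem_Ioc (n : ℕ) :
    MeasurableSet {x : Fin n → ℝ | ∀ i, x i ∈ Set.Ioc (0 : ℝ) (0 + 1)} := by
  have : {x : Fin n → ℝ | ∀ i, x i ∈ Set.Ioc (0 : ℝ) (0 + 1)} =
      Set.univ.pi fun _ => Set.Ioc (0 : ℝ) (0 + 1) := by ext; simp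
  rw [this]
  exact MeasurableSet.univ_pi fun _ => measurableSet_Ioc

theorem norm_le_one_of_forall_mem_Ioc {n : ℕ} {x : Fin n → ℝ}
    (hx : ∀ i, x i ∈ Set.Ioc (0 : ℝ) (0 + 1)) : ‖x‖ ≤ 1 := by
  refine (pi_norm_le_iff_of_nonneg zero_le_one).2 fun i => ?_
  rw [Real.norm_eq_abs, abs_le]
  constructor <;> linarith [(hx i).1, (hx i).2]

theorem measurableSet_integerCube {n : ℕ} (k : Fin n → ℤ) : MeasurableSet (integerCube k) :=
  (measurableSet_setOf_forall_mem_Ioc n).preimage (by fun_prop)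

theorem pairwise_disjoint_integerCube (n : ℕ) :
    Pairwise (Function.onFun Disjoint (integerCube (n := n))) := by
  intro k l hkl
  refine Set.disjoint_left.2 fun x hx hy => hkl ?_
  ext i
  have h1 := hx i
  have h2 := hy i
  simp only [Pi.sub_apply, Set.mem_Ioc] at h1 h2
  have h3 : (k i : ℝ) < l i + 1 := by linarith
  have h4 : (l i : ℝ) < k i + 1 := by linarith
  have h5 : k i < l i + 1 := by exact_mod_cast h3
  have h6 : l i < k i + 1 := by exact_mod_cast h4
  omega

theorem iUnion_integerCube (n : ℕ) : ⋃ k : Fin n → ℤ, integerCube k = Set.univ := by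
  refine Set.eq_univ_of_forall fun x => Set.mem_iUnion.2 ⟨fun i => ⌈x i⌉ - 1, fun i => ?_⟩
  have h1 := Int.le_ceil (x i)
  have h2 := Int.ceil_lt_add_one (x i)
  simp only [Pi.sub_apply, Set.mem_Ioc]
  push_cast
  constructor <;> linarith

theorem volume_integerCube {n : ℕ} (k : Fin n → ℤ) : volume (integerCube k) = 1 := by
  have : {x : Fin n → ℝ | ∀ i, x i ∈ Set.Ioc (0 : ℝ) (0 + 1)} =
      Set.univ.pi fun _ => Set.Ioc (0 : ℝ) (0 + 1) := by ext; simp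
  rw [integerCube, (measurePreserving_sub_right volume (fun i => (k i : ℝ))).measure_preimage
    (measurableSet_setOf_forall_mem_Ioc n).nullMeasurableSet, this, Real.volume_pi_Ioc]
  simp

theorem setIntegral_finsum_translates {n : ℕ} {F : (Fin n → ℝ) → ℂ} (hF : Continuous F)
    (hc : HasCompactSupport F) :
    ∫ x in {x : Fin n → ℝ | ∀ i, x i ∈ Set.Ioc (0 : ℝ) (0 + 1)},
      ∑ᶠ k : Fin n → ℤ, F (x + fun i => (k i : ℝ)) = ∫ x, F x := by
  obtain ⟨R, hR⟩ := hc.exists_norm_bound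
  set D : Set (Fin n → ℝ) := {x | ∀ i, x i ∈ Set.Ioc (0 : ℝ) (0 + 1)}
  have hDm : MeasurableSet D := measurableSet_setOf_forall_mem_Ioc n
  have hDn : ∀ x ∈ D, ‖x‖ ≤ 1 := fun x hx => norm_le_one_of_forall_mem_Ioc hx
  have hFi : Integrable F := hF.integrable_of_hasCompactSupport hc
  set T := (finite_setOf_norm_intCast_le n (R + 1)).toFinset with hT
  have hout : ∀ x ∈ D, ∀ k ∉ T, F (x + fun i => (k i : ℝ)) = 0 := by
    intro x hx k hk
    by_contra h
    refine hk ?_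
    rw [hT, Set.Finite.mem_toFinset, Set.mem_ofPred_eq]
    have h1 := hR _ h
    have h2 := hDn x hx
    have h3 := norm_sub_le (x + fun i => (k i : ℝ)) x
    rw [add_sub_cancel_left] at h3
    linarith
  have hleft : ∫ x in D, ∑ᶠ k : Fin n → ℤ, F (x + fun i => (k i : ℝ)) =
      ∑ k ∈ T, ∫ x in D, F (x + fun i => (k i : ℝ)) := by
    rw [← integral_finsetSum _ fun k _ => (hFi.comp_add_right _).integrableOn]
    refine setIntegral_congr_fun hDm fun x hx => ?_
    refine finsum_eq_sum_of_support_subset _ fun k hk => ?_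
    by_contra h
    exact hk (hout x hx k h)
  have hint : ∀ k, ∫ x in integerCube k, F x = ∫ x in D, F (x + fun i => (k i : ℝ)) := by
    intro k
    have h := (measurePreserving_sub_right volume (fun i => (k i : ℝ))).setIntegral_preimage_emb
      (MeasurableEquiv.subRight _).measurableEmbedding (fun x => F (x + fun i => (k i : ℝ))) D
    simp only [sub_add_cancel] at h
    exact h
  have h1 := hasSum_integral_iUnion measurableSet_integerCube (pairwise_disjoint_integerCube n)
    (f := F) (μ := volume) (by rw [iUnion_integerCube]; exact hFi.integrableOn)
  rw [iUnion_integerCube, setIntegral_univ] at h1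
  simp only [hint] at h1
  rw [hleft]
  refine (hasSum_sum_of_ne_finset_zero fun k hk => ?_).unique h1
  rw [setIntegral_congr_fun hDm fun x hx => hout x hx k hk]
  simp

theorem continuous_finsum_translates {n : ℕ} {F : (Fin n → ℝ) → ℂ} (hF : Continuous F)
    (hc : HasCompactSupport F) :
    Continuous fun x => ∑ᶠ k : Fin n → ℤ, F (x + fun i => (k i : ℝ)) := by
  obtain ⟨R, hR⟩ := hc.exists_norm_bound
  refine continuous_finsum (fun k => by fun_prop) fun x => ⟨Metric.ball x 1,
    Metric.ball_mem_nhds x one_pos, ?_⟩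
  refine (finite_setOf_norm_intCast_le n (R + 1 + ‖x‖)).subset ?_
  rintro k ⟨y, hy, hyx⟩
  have h1 := hR _ hy
  have h3 := norm_sub_le (y + fun i => (k i : ℝ)) y
  rw [add_sub_cancel_left] at h3
  have h4 := norm_sub_norm_le y x
  rw [Metric.mem_ball, dist_eq_norm] at hyx
  rw [Set.mem_ofPred_eq]
  linarith

theorem UnitAddTorus.mFourier_coe {n : ℕ} (m : Fin n → ℤ) (x : Fin n → ℝ) :
    UnitAddTorus.mFourier m (fun i => (x i : UnitAddCircle)) =
      Complex.exp (Complex.I * (2 * Real.pi * ∑ i, m i * x i : ℝ)) := by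
  simp only [UnitAddTorus.mFourier, ContinuousMap.coe_mk, fourier_coe_apply]
  rw [← Complex.exp_sum]
  congr 1
  push_cast
  rw [Finset.mul_sum, Finset.mul_sum]
  refine Finset.sum_congr rfl fun i _ => ?_
  ring

theorem poisson_summation {n : ℕ} {F : (Fin n → ℝ) → ℂ} (hF : Continuous F)
    (hc : HasCompactSupport F)
    (hs : Summable fun m : Fin n → ℤ =>
      ∫ x, F x * Complex.exp (-(Complex.I * (2 * Real.pi * ∑ i, m i * x i : ℝ)))) :
    HasSum (fun m : Fin n → ℤ =>
      ∫ x, F x * Complex.exp (-(Complex.I * (2 * Real.pi * ∑ i, m i * x i : ℝ))))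
      (∑ᶠ k : Fin n → ℤ, F fun i => (k i : ℝ)) := by
  set P : (Fin n → ℝ) → ℂ := fun x => ∑ᶠ k : Fin n → ℤ, F (x + fun i => (k i : ℝ)) with hP
  have hPc : Continuous P := continuous_finsum_translates hF hc
  have hper : ∀ (x : Fin n → ℝ) (j : Fin n → ℤ), P (x + fun i => (j i : ℝ)) = P x := by
    intro x j
    rw [hP]
    refine Eq.trans ?_ (finsum_comp_equiv (Equiv.addLeft j)
      (f := fun k : Fin n → ℤ => F (x + fun i => (k i : ℝ))))
    refine finsum_congr fun k => ?_
    congr 1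
    ext i
    simp [add_assoc]
  let q : (Fin n → ℝ) → UnitAddTorus (Fin n) := fun x i => (x i : UnitAddCircle)
  have hq : IsOpenQuotientMap q :=
    IsOpenQuotientMap.piMap fun _ => QuotientAddGroup.isOpenQuotientMap_mk
  obtain ⟨s, hsec⟩ := hq.surjective.hasRightInverse
  have hfq : ∀ x, P (s (q x)) = P x := by
    intro x
    have h : ∀ i, ∃ j : ℤ, (j : ℝ) = s (q x) i - x i := by
      intro i
      have h1 : ((s (q x) i : ℝ) : UnitAddCircle) = (x i : UnitAddCircle) :=
        congrFun (hsec (q x)) i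
      have h2 : ((s (q x) i - x i : ℝ) : UnitAddCircle) = 0 := by
        rw [AddCircle.coe_sub, h1, sub_self]
      obtain ⟨j, hj⟩ := (AddCircle.coe_eq_zero_iff 1).1 h2
      exact ⟨j, by simpa using hj⟩
    choose j hj using h
    rw [← hper x j]
    congr 1
    ext i
    simp [hj]
  let f : C(UnitAddTorus (Fin n), ℂ) :=
    ⟨P ∘ s, hq.isQuotientMap.continuous_iff.2 (by
      have : (P ∘ s) ∘ q = P := funext hfq
      rw [this]
      exact hPc)⟩
  have hcoeff : ∀ m : Fin n → ℤ, UnitAddTorus.mFourierCoeff f m =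
      ∫ x, F x * Complex.exp (-(Complex.I * (2 * Real.pi * ∑ i, m i * x i : ℝ))) := by
    intro m
    have h := setIntegral_finsum_translates (F := fun x => F x *
      Complex.exp (-(Complex.I * (2 * Real.pi * ∑ i, m i * x i : ℝ)))) (by fun_prop) hc.mul_right
    rw [UnitAddTorus.mFourierCoeff_eq_integral f m 0, ← h]
    congr 1
    ext x
    have h1 : f (fun i => (x i : UnitAddCircle)) = P x := hfq x
    rw [h1, UnitAddTorus.mFourier_coe, smul_eq_mul, hP]
    simp only
    rw [mul_finsum]
    refine finsum_congr fun k => ?_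
    rw [mul_comm]
    congr 1
    rw [Complex.exp_eq_exp_iff_exists_int]
    refine ⟨∑ i, m i * k i, ?_⟩
    simp only [Pi.neg_apply, Pi.add_apply]
    push_cast
    simp only [mul_add, neg_mul, Finset.sum_add_distrib, Finset.sum_neg_distrib]
    ring
  have hsum : Summable (UnitAddTorus.mFourierCoeff f) := by
    refine hs.congr fun m => (hcoeff m).symm
  have h := UnitAddTorus.hasSum_mFourier_series_apply_of_summable hsum (q 0)
  have h0 : f (q 0) = ∑ᶠ k : Fin n → ℤ, F fun i => (k i : ℝ) := by
    refine (hfq 0).trans ?_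
    simp [hP]
  rw [h0] at h
  convert h using 2 with m
  rw [hcoeff, show q 0 = fun i => (((0 : Fin n → ℝ) i : ℝ) : UnitAddCircle) from rfl,
    UnitAddTorus.mFourier_coe]
  simp

theorem integrableOn_rpow_mul_inv_one_add_pow {a : ℝ} {M : ℕ} (ha : -1 < a) (haM : a - M < -1) :
    IntegrableOn (fun y : ℝ => y ^ a * ((1 + y) ^ M)⁻¹) (Set.Ioi 0) := by
  have hm : AEStronglyMeasurable (fun y : ℝ => y ^ a * ((1 + y) ^ M)⁻¹) :=
    (by fun_prop : Measurable fun y : ℝ => y ^ a * ((1 + y) ^ M)⁻¹).aestronglyMeasurable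
  rw [← Set.Ioc_union_Ioi_eq_Ioi zero_le_one]
  refine IntegrableOn.union ?_ ?_
  · have h : IntegrableOn (fun y : ℝ => y ^ a) (Set.Ioc 0 1) :=
      (intervalIntegrable_iff_integrableOn_Ioc_of_le zero_le_one).1
        (intervalIntegral.intervalIntegrable_rpow' ha)
    refine Integrable.mono' h hm.restrict ?_
    refine (ae_restrict_iff' measurableSet_Ioc).2 (.of_forall fun y hy => ?_)
    have hy0 : 0 < y := hy.1
    rw [Real.norm_of_nonneg (by positivity)]
    refine mul_le_of_le_one_right (by positivity) (inv_le_one_of_one_le₀ ?_)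
    exact one_le_pow₀ (by linarith)
  · refine Integrable.mono' (integrableOn_Ioi_rpow_of_lt haM one_pos) hm.restrict ?_
    refine (ae_restrict_iff' measurableSet_Ioi).2 (.of_forall fun y hy => ?_)
    have hy0 : (0 : ℝ) < y := one_pos.trans hy
    rw [Real.norm_of_nonneg (by positivity), Real.rpow_sub hy0, Real.rpow_natCast, div_eq_mul_inv]
    gcongr
    linarith

theorem one_le_norm_intCast {n : ℕ} {m : Fin n → ℤ} (hm : m ≠ 0) :
    1 ≤ ‖fun i => (m i : ℝ)‖ := by
  obtain ⟨j, hj⟩ := Function.ne_iff.1 hm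
  refine le_trans ?_ (norm_le_pi_norm _ j)
  rw [Real.norm_eq_abs]
  exact_mod_cast Int.one_le_abs hj

theorem summable_and_tsum_le_integral_norm {n : ℕ} (hn : n ≠ 0) {φ : ℝ → ℝ}
    (hφ : AntitoneOn φ (Set.Ioi 0)) (hφ0 : ∀ y, 0 ≤ φ y)
    (hi : Integrable fun x : Fin n → ℝ => φ ‖x‖) {f : (Fin n → ℤ) → ℝ} (hf0 : ∀ k, 0 ≤ f k)
    (hf : f 0 = 0) (hfφ : ∀ k ≠ 0, f k ≤ φ (2 * ‖fun i => (k i : ℝ)‖)) :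
    Summable f ∧ ∑' k, f k ≤ ∫ x : Fin n → ℝ, φ ‖x‖ := by
  have : Nonempty (Fin n) := ⟨⟨0, Nat.pos_of_ne_zero hn⟩⟩
  have key : ∑' k, ENNReal.ofReal (f k) ≤ ENNReal.ofReal (∫ x : Fin n → ℝ, φ ‖x‖) := by
    rw [ofReal_integral_eq_lintegral_ofReal hi (.of_forall fun x => hφ0 _), ← setLIntegral_univ,
      ← iUnion_integerCube, lintegral_iUnion measurableSet_integerCube
        (pairwise_disjoint_integerCube n)]
    refine ENNReal.tsum_le_tsum fun k => ?_
    by_cases hk : k = 0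
    · simp [hk, hf]
    calc ENNReal.ofReal (f k) = ∫⁻ _ in integerCube k, ENNReal.ofReal (f k) := by
          rw [setLIntegral_const, volume_integerCube, mul_one]
      _ ≤ _ := by
        refine lintegral_mono_ae ?_
        have h0 : ∀ᵐ x : Fin n → ℝ ∂volume.restrict (integerCube k), x ≠ 0 :=
          ae_restrict_of_ae (Measure.ae_ne _ 0)
        filter_upwards [h0, ae_restrict_mem (measurableSet_integerCube k)] with x hx hxk
        refine ENNReal.ofReal_le_ofReal ((hfφ k hk).trans ?_)
        have h1 := one_le_norm_intCast hk
        have h2 := norm_le_one_of_forall_mem_Ioc hxk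
        have h3 := norm_le_norm_add_norm_sub' x (fun i => (k i : ℝ))
        refine hφ (norm_pos_iff.2 hx) (Set.mem_Ioi.2 (by linarith)) (by linarith)
  have hs : Summable f := by
    have h := ENNReal.summable_toReal (ne_top_of_le_ne_top ENNReal.ofReal_ne_top key)
    simpa [ENNReal.toReal_ofReal (hf0 _)] using h
  refine ⟨hs, ?_⟩
  rw [← ENNReal.ofReal_tsum_of_nonneg hf0 hs] at key
  exact (ENNReal.ofReal_le_ofReal_iff (integral_nonneg fun x => hφ0 _)).1 key

theorem exists_lattice_sum_bound {n : ℕ} (hn : n ≠ 0) {b : ℝ} (hb : 0 < b) (hbn : b < n) :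
    ∃ C : ℝ, 0 ≤ C ∧ ∀ q : ℝ, 0 < q →
      Summable (fun m : Fin n → ℤ => ‖fun i => (m i : ℝ)‖ ^ (-b) *
        ((1 + q * ‖fun i => (m i : ℝ)‖) ^ n)⁻¹) ∧
      ∑' m : Fin n → ℤ, ‖fun i => (m i : ℝ)‖ ^ (-b) * ((1 + q * ‖fun i => (m i : ℝ)‖) ^ n)⁻¹ ≤
        C * q ^ (b - n) := by
  have : Nonempty (Fin n) := ⟨⟨0, Nat.pos_of_ne_zero hn⟩⟩
  have hI : Integrable fun x : Fin n → ℝ => ‖x‖ ^ (-b) * ((1 + ‖x‖) ^ n)⁻¹ := by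
    rw [integrable_fun_norm_addHaar volume (f := fun y => y ^ (-b) * ((1 + y) ^ n)⁻¹)]
    refine (integrableOn_rpow_mul_inv_one_add_pow (a := n - 1 - b) (M := n) (by linarith)
      (by linarith)).congr_fun (fun y hy => ?_) measurableSet_Ioi
    have hy0 : (0 : ℝ) < y := hy
    simp only [smul_eq_mul]
    rw [← mul_assoc, ← Real.rpow_natCast y, ← Real.rpow_add hy0]
    congr 2
    rw [Module.finrank_fin_fun, Nat.cast_sub (Nat.one_le_iff_ne_zero.2 hn)]
    push_cast
    ring
  set J : ℝ := ∫ x : Fin n → ℝ, ‖x‖ ^ (-b) * ((1 + ‖x‖) ^ n)⁻¹ with hJ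
  have hJ0 : 0 ≤ J := integral_nonneg fun x => by positivity
  refine ⟨2 ^ n * J, by positivity, fun q hq => ?_⟩
  set φ : ℝ → ℝ := fun y => (|y| / 2) ^ (-b) * ((1 + q * (|y| / 2)) ^ n)⁻¹ with hφ
  have hscale : ∀ x : Fin n → ℝ, φ ‖x‖ =
      q ^ b * (‖(q / 2) • x‖ ^ (-b) * ((1 + ‖(q / 2) • x‖) ^ n)⁻¹) := by
    intro x
    rw [hφ]
    simp only [abs_norm]
    rw [norm_smul, Real.norm_of_nonneg (by positivity), show q / 2 * ‖x‖ = q * (‖x‖ / 2) by ring,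
      Real.mul_rpow hq.le (by positivity), ← mul_assoc, ← mul_assoc, ← Real.rpow_add hq]
    simp
  have hi : Integrable fun x : Fin n → ℝ => φ ‖x‖ := by
    simp only [hscale]
    exact (hI.comp_smul (by positivity : q / 2 ≠ 0)).const_mul _
  have hval : ∫ x : Fin n → ℝ, φ ‖x‖ = 2 ^ n * J * q ^ (b - n) := by
    simp only [hscale]
    rw [integral_const_mul, Measure.integral_comp_smul volume
      (fun x : Fin n → ℝ => ‖x‖ ^ (-b) * ((1 + ‖x‖) ^ n)⁻¹), ← hJ, Module.finrank_fin_fun,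
      abs_of_nonneg (by positivity), smul_eq_mul, Real.rpow_sub hq, Real.rpow_natCast,
      div_pow]
    field_simp
  rw [← hval]
  refine summable_and_tsum_le_integral_norm hn (fun x hx y hy hxy => ?_) (fun y => by positivity)
    hi (fun k => by positivity) ?_ fun k hk => ?_
  · rw [Set.mem_Ioi] at hx hy
    simp only [hφ, abs_of_pos hx, abs_of_pos hy]
    gcongr ?_ * ?_
    · exact Real.rpow_le_rpow_of_nonpos (by positivity) (by linarith) (by linarith)
    · gcongr
  · have : ‖fun i : Fin n => (((0 : Fin n → ℤ) i : ℤ) : ℝ)‖ = 0 := by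
      simp [← Pi.zero_def]
    rw [this, Real.zero_rpow (by linarith), zero_mul]
  · rw [hφ]
    simp only
    rw [abs_of_nonneg (by positivity), mul_div_cancel_left₀ _ (two_ne_zero)]

theorem exists_dual_eq_two_pi_mul {n : ℕ} (m : Fin n → ℤ) {R : ℝ} (hR : 0 < R) :
    ∃ ξ : (Fin n → ℝ) →L[ℝ] ℝ, (∀ x, ξ x = 2 * Real.pi * ∑ i, m i * (R * x i)) ∧
      R * ‖fun i => (m i : ℝ)‖ ≤ ‖ξ‖ := by
  set ξ : (Fin n → ℝ) →L[ℝ] ℝ :=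
    ∑ i, (2 * Real.pi * R * m i) • ContinuousLinearMap.proj (R := ℝ) (φ := fun _ : Fin n => ℝ) i
    with hξ
  have hξa : ∀ x, ξ x = ∑ i, 2 * Real.pi * R * m i * x i := fun x => by simp [hξ]
  refine ⟨ξ, fun x => ?_, ?_⟩
  · rw [hξa, Finset.mul_sum]
    exact Finset.sum_congr rfl fun i _ => by ring
  · rw [← le_div_iff₀' hR]
    refine (pi_norm_le_iff_of_nonneg (by positivity)).2 fun i => ?_
    rw [le_div_iff₀' hR]
    have h1 := ξ.le_opNorm (Pi.single i 1)
    rw [hξa, Finset.sum_eq_single i (by intro b _ hb; simp [hb]) (by simp), Pi.single_eq_same,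
      Pi.norm_single, norm_one, mul_one, mul_one, norm_mul, Real.norm_of_nonneg (by positivity)]
      at h1
    refine le_trans ?_ h1
    have := Real.pi_gt_three
    gcongr
    nlinarith

theorem integral_comp_inv_smul_mul_exp {n : ℕ} (F : (Fin n → ℝ) → ℂ) (m : Fin n → ℤ) {R : ℝ}
    (hR : 0 < R) {ξ : (Fin n → ℝ) →L[ℝ] ℝ}
    (hξ : ∀ x, ξ x = 2 * Real.pi * ∑ i, m i * (R * x i)) :
    ∫ x, F (R⁻¹ • x) * Complex.exp (-(Complex.I * (2 * Real.pi * ∑ i, m i * x i : ℝ))) =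
      (R : ℂ) ^ n * ∫ x, F x * Complex.exp (-(Complex.I * (ξ x : ℝ))) := by
  have h := Measure.integral_comp_inv_smul volume
    (fun x : Fin n → ℝ => F x * Complex.exp (-(Complex.I * (ξ x : ℝ)))) R
  rw [Module.finrank_fin_fun, abs_of_pos (by positivity), Complex.real_smul,
    Complex.ofReal_pow] at h
  rw [← h]
  refine integral_congr_ae (.of_forall fun x => ?_)
  have hx : ξ (R⁻¹ • x) = 2 * Real.pi * ∑ i, m i * x i := by
    rw [hξ]
    congr 1
    refine Finset.sum_congr rfl fun i _ => ?_
    rw [Pi.smul_apply, smul_eq_mul, mul_inv_cancel_left₀ hR.ne']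
  simp only [hx]

theorem exists_norm_finsum_sub_integral_le {n : ℕ} (hn : 2 ≤ n) :
    ∃ K : ℝ, 0 ≤ K ∧ ∀ F : (Fin n → ℝ) → ℂ, Continuous F → HasCompactSupport F → ∀ C δ : ℝ, 0 < δ →
      (∀ ξ : (Fin n → ℝ) →L[ℝ] ℝ, 1 ≤ ‖ξ‖ →
        (1 + δ * ‖ξ‖) ^ n * ‖∫ x, F x * Complex.exp (-(Complex.I * (ξ x : ℝ)))‖ ≤
          C * ‖ξ‖ ^ (-((n + 1) / 2 : ℝ))) →
      ∀ R : ℝ, 1 ≤ R →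
        ‖(∑ᶠ k : Fin n → ℤ, F (R⁻¹ • fun i => (k i : ℝ))) - (R : ℂ) ^ n * ∫ x, F x‖ ≤
          K * C * δ ^ (-((n - 1) / 2 : ℝ)) := by
  have hn2 : (2 : ℝ) ≤ n := by exact_mod_cast hn
  obtain ⟨K, hK0, hK⟩ := exists_lattice_sum_bound (n := n) (by omega) (b := (n + 1) / 2)
    (by positivity) (by linarith)
  refine ⟨K, hK0, fun F hF hc C δ hδ hbd R hR => ?_⟩
  have hR0 : 0 < R := by linarith
  set c : (Fin n → ℤ) → ℂ := fun m => ∫ x, F (R⁻¹ • x) *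
    Complex.exp (-(Complex.I * (2 * Real.pi * ∑ i, m i * x i : ℝ))) with hcdef
  obtain ⟨hs, hle⟩ := hK (δ * R) (by positivity)
  have hc0 : c 0 = (R : ℂ) ^ n * ∫ x, F x := by
    rw [hcdef]
    simp only [Pi.zero_apply, Int.cast_zero, zero_mul, Finset.sum_const_zero, mul_zero,
      Complex.ofReal_zero, neg_zero, Complex.exp_zero, mul_one]
    rw [Measure.integral_comp_inv_smul, Module.finrank_fin_fun, abs_of_pos (by positivity)]
    simp
  have hcm : ∀ m ≠ 0, ‖c m‖ ≤ C * R ^ (n - (n + 1) / 2 : ℝ) *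
      (‖fun i => (m i : ℝ)‖ ^ (-((n + 1) / 2 : ℝ)) *
        ((1 + δ * R * ‖fun i => (m i : ℝ)‖) ^ n)⁻¹) := by
    intro m hm
    obtain ⟨ξ, hξa, hξn⟩ := exists_dual_eq_two_pi_mul m hR0
    have hcξ : c m = (R : ℂ) ^ n * ∫ x, F x * Complex.exp (-(Complex.I * (ξ x : ℝ))) :=
      integral_comp_inv_smul_mul_exp F m hR0 hξa
    have hm1 := one_le_norm_intCast hm
    have hξ1 : 1 ≤ ‖ξ‖ := by nlinarith
    have hξ0 : 0 < ‖ξ‖ := by linarith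
    have hC : 0 ≤ C := by
      have := (by positivity : (0 : ℝ) ≤ _).trans (hbd ξ hξ1)
      exact nonneg_of_mul_nonneg_left this (by positivity)
    have h2 := hbd ξ hξ1
    rw [mul_comm, ← le_div_iff₀ (by positivity), div_eq_mul_inv] at h2
    rw [hcξ, norm_mul, norm_pow, Complex.norm_real, Real.norm_of_nonneg hR0.le]
    calc R ^ n * ‖∫ x, F x * Complex.exp (-(Complex.I * (ξ x : ℝ)))‖
        ≤ R ^ n * (C * ‖ξ‖ ^ (-((n + 1) / 2 : ℝ)) * ((1 + δ * ‖ξ‖) ^ n)⁻¹) := by gcongr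
      _ ≤ R ^ n * (C * (R * ‖fun i => (m i : ℝ)‖) ^ (-((n + 1) / 2 : ℝ)) *
          ((1 + δ * (R * ‖fun i => (m i : ℝ)‖)) ^ n)⁻¹) := by
        gcongr R ^ n * (C * ?_ * ?_)
        · exact Real.rpow_le_rpow_of_nonpos (by positivity) hξn (by linarith)
        · gcongr
      _ = _ := by
        rw [Real.mul_rpow hR0.le (by positivity), sub_eq_add_neg, Real.rpow_add hR0,
          Real.rpow_natCast]
        ring_nf
  have hsc : Summable c := by
    refine Summable.of_norm_bounded_eventually (hs.mul_left (C * R ^ (n - (n + 1) / 2 : ℝ))) ?_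
    filter_upwards [(Set.finite_singleton (0 : Fin n → ℤ)).compl_mem_cofinite] with m hm
    exact hcm m hm
  have hS : HasSum c (∑ᶠ k : Fin n → ℤ, F (R⁻¹ • fun i => (k i : ℝ))) := by
    refine poisson_summation (F := fun x => F (R⁻¹ • x)) (by fun_prop) ?_ hsc
    exact hc.comp_homeomorph (Homeomorph.smulOfNeZero R⁻¹ (by positivity))
  have hS0 := hasSum_ite_sub_hasSum hS 0
  rw [hc0] at hS0
  rw [← hS0.tsum_eq]
  have hCn : ∀ m : Fin n → ℤ, ‖if m = 0 then 0 else c m‖ ≤ C * R ^ (n - (n + 1) / 2 : ℝ) *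
      (‖fun i => (m i : ℝ)‖ ^ (-((n + 1) / 2 : ℝ)) *
        ((1 + δ * R * ‖fun i => (m i : ℝ)‖) ^ n)⁻¹) := by
    intro m
    split_ifs with h
    · rw [h, show ‖fun i : Fin n => (((0 : Fin n → ℤ) i : ℤ) : ℝ)‖ = 0 by simp [← Pi.zero_def],
        Real.zero_rpow (by linarith)]
      simp
    · exact hcm m h
  have hC : 0 ≤ C := by
    let i : Fin n := ⟨0, by omega⟩
    have h1 : 1 ≤ ‖ContinuousLinearMap.proj (R := ℝ) (φ := fun _ : Fin n => ℝ) i‖ := by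
      have := (ContinuousLinearMap.proj (R := ℝ) (φ := fun _ : Fin n => ℝ) i).le_opNorm
        (Pi.single i 1)
      simpa [Pi.norm_single] using this
    have := (by positivity : (0 : ℝ) ≤ _).trans (hbd _ h1)
    exact nonneg_of_mul_nonneg_left this (Real.rpow_pos_of_pos (by linarith) _)
  refine (tsum_of_norm_bounded (hs.mul_left _).hasSum hCn).trans ?_
  rw [tsum_mul_left]
  refine (mul_le_mul_of_nonneg_left hle (by positivity)).trans (le_of_eq ?_)
  rw [Real.mul_rpow hδ.le hR0.le, show ((n + 1) / 2 - n : ℝ) = -(n - (n + 1) / 2) by ring,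
    Real.rpow_neg hR0.le, show (n - (n + 1) / 2 : ℝ) = (n - 1) / 2 by ring]
  field_simp

section Gauge

variable {n : ℕ} {g : (Fin n → ℝ) → ℝ}

theorem gaugeFunction_zero (hg_hom : ∀ t : ℝ, 0 < t → ∀ x, g (t • x) = t * g x) : g 0 = 0 := by
  have := hg_hom 2 two_pos 0
  rw [smul_zero] at this
  linarith

theorem gaugeFunction_nonneg (hg_pos : ∀ x, x ≠ 0 → 0 < g x)
    (hg_hom : ∀ t : ℝ, 0 < t → ∀ x, g (t • x) = t * g x) (x : Fin n → ℝ) : 0 ≤ g x := by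
  rcases eq_or_ne x 0 with rfl | hx
  · rw [gaugeFunction_zero hg_hom]
  · exact (hg_pos x hx).le

theorem exists_mul_norm_le_gauge (hg_cont : Continuous g) (hg_pos : ∀ x, x ≠ 0 → 0 < g x)
    (hg_hom : ∀ t : ℝ, 0 < t → ∀ x, g (t • x) = t * g x) :
    ∃ c : ℝ, 0 < c ∧ ∀ x, c * ‖x‖ ≤ g x := by
  rcases (Metric.sphere (0 : Fin n → ℝ) 1).eq_empty_or_nonempty with h | h
  · refine ⟨1, one_pos, fun x => ?_⟩
    rcases eq_or_ne x 0 with rfl | hx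
    · simp [gaugeFunction_zero hg_hom]
    · have : (‖x‖⁻¹ • x) ∈ Metric.sphere (0 : Fin n → ℝ) 1 := by simp [norm_smul, hx]
      simp [h] at this
  · obtain ⟨y, hy, hmin⟩ := (isCompact_sphere (0 : Fin n → ℝ) 1).exists_isMinOn h
      hg_cont.continuousOn
    have hy0 : y ≠ 0 := by
      rintro rfl
      simp at hy
    refine ⟨g y, hg_pos y hy0, fun x => ?_⟩
    rcases eq_or_ne x 0 with rfl | hx
    · simp [gaugeFunction_zero hg_hom]
    · have hxn : 0 < ‖x‖ := norm_pos_iff.2 hx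
      have h1 : (‖x‖⁻¹ • x) ∈ Metric.sphere (0 : Fin n → ℝ) 1 := by simp [norm_smul, hx]
      have h2 : g y ≤ g (‖x‖⁻¹ • x) := hmin h1
      rw [hg_hom _ (by positivity), ← div_eq_inv_mul, le_div_iff₀ hxn] at h2
      exact h2

theorem isCompact_gauge_le (hg_cont : Continuous g) (hg_pos : ∀ x, x ≠ 0 → 0 < g x)
    (hg_hom : ∀ t : ℝ, 0 < t → ∀ x, g (t • x) = t * g x) (t : ℝ) : IsCompact {x | g x ≤ t} := by
  obtain ⟨c, hc, h⟩ := exists_mul_norm_le_gauge hg_cont hg_pos hg_hom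
  refine (isCompact_closedBall (0 : Fin n → ℝ) (t / c)).of_isClosed_subset
    (isClosed_le hg_cont continuous_const) fun x hx => ?_
  rw [mem_closedBall_zero_iff, le_div_iff₀' hc]
  exact (h x).trans hx

theorem fderiv_gauge_apply_self (hg_hom : ∀ t : ℝ, 0 < t → ∀ x, g (t • x) = t * g x)
    {x : Fin n → ℝ} (hx : DifferentiableAt ℝ g x) : fderiv ℝ g x x = g x := by
  have h1 : HasDerivAt (fun t : ℝ => t • x) x 1 := by
    simpa using (hasDerivAt_id (1 : ℝ)).smul_const x
  have h2 : HasDerivAt (fun t : ℝ => g (t • x)) (fderiv ℝ g x x) 1 := by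
    have h : HasFDerivAt g (fderiv ℝ g x) ((1 : ℝ) • x) := by
      rw [one_smul]
      exact hx.hasFDerivAt
    exact h.comp_hasDerivAt (1 : ℝ) h1
  have h3 : HasDerivAt (fun t : ℝ => g (t • x)) (g x) 1 := by
    have h : HasDerivAt (fun t : ℝ => t * g x) (g x) 1 := by
      simpa using (hasDerivAt_id (1 : ℝ)).mul_const (g x)
    refine h.congr_of_eventuallyEq ?_
    filter_upwards [lt_mem_nhds one_pos] with t ht
    exact hg_hom t ht x
  exact h2.unique h3

theorem eq_zero_of_hessian_add_fderiv_eq_zero (hg_pos : ∀ x, x ≠ 0 → 0 < g x)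
    (hg_hom : ∀ t : ℝ, 0 < t → ∀ x, g (t • x) = t * g x) {x : Fin n → ℝ} (hx : x ≠ 0)
    (hg : ContDiffAt ℝ ∞ g x)
    (hnd : ∀ v, (∀ w, fderiv ℝ (fderiv ℝ g) x v w = 0) ↔ ∃ c : ℝ, v = c • x)
    {m ν : ℝ} {v : Fin n → ℝ} (hm : m ≠ 0) (hv : fderiv ℝ g x v = 0)
    (h : ∀ w, m * fderiv ℝ (fderiv ℝ g) x v w + ν * fderiv ℝ g x w = 0) : v = 0 ∧ ν = 0 := by
  have hgx := hg_pos x hx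
  have hE := fderiv_gauge_apply_self hg_hom (hg.differentiableAt (by simp))
  have hsymm : IsSymmSndFDerivAt ℝ g x := hg.isSymmSndFDerivAt (by
    rw [minSmoothness_of_isRCLikeNormedField]
    exact WithTop.coe_le_coe.2 (le_top : (2 : ℕ∞) ≤ ⊤))
  have hvx : fderiv ℝ (fderiv ℝ g) x v x = 0 := by
    rw [hsymm.eq v x]
    exact (hnd x).2 ⟨1, (one_smul ℝ x).symm⟩ v
  have hν : ν = 0 := by
    have := h x
    rw [hvx, hE, mul_zero, zero_add] at this
    exact (mul_eq_zero.1 this).resolve_right hgx.ne'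
  refine ⟨?_, hν⟩
  obtain ⟨c, hc⟩ := (hnd v).1 fun w => by
    have := h w
    rw [hν, zero_mul, add_zero] at this
    exact (mul_eq_zero.1 this).resolve_left hm
  rw [hc, map_smul, hE, smul_eq_mul] at hv
  rw [hc, (mul_eq_zero.1 hv).resolve_right hgx.ne', zero_smul]

theorem exists_contDiff_eq_gauge (hg_cont : Continuous g) (hg_pos : ∀ x, x ≠ 0 → 0 < g x)
    (hg_hom : ∀ t : ℝ, 0 < t → ∀ x, g (t • x) = t * g x)
    (hg_smooth : ContDiffOn ℝ ∞ g {(0 : Fin n → ℝ)}ᶜ) :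
    ∃ G : (Fin n → ℝ) → ℝ, ContDiff ℝ ∞ G ∧ (∀ x, G x ≤ g x) ∧ ∀ x, 1 / 4 ≤ g x → G x = g x := by
  have h0 : {x | g x < 1 / 4} ∈ 𝓝 (0 : Fin n → ℝ) :=
    (isOpen_lt hg_cont continuous_const).mem_nhds (by simp [gaugeFunction_zero hg_hom])
  obtain ⟨r, hr, hball⟩ := Metric.mem_nhds_iff.1 h0
  let f : ContDiffBump (0 : Fin n → ℝ) := ⟨r / 2, r, by positivity, by linarith⟩
  refine ⟨fun x => (1 - f x) * g x, contDiff_iff_contDiffAt.2 fun x => ?_, fun x => ?_,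
    fun x hx => ?_⟩
  · rcases eq_or_ne x 0 with rfl | hx
    · refine contDiffAt_const (c := (0 : ℝ)) |>.congr_of_eventuallyEq ?_
      filter_upwards [f.eventuallyEq_one] with y hy
      simp [hy]
    · exact (contDiffAt_const.sub f.contDiffAt).mul
        (hg_smooth.contDiffAt (isOpen_compl_singleton.mem_nhds hx))
  · have h1 := gaugeFunction_nonneg hg_pos hg_hom x
    have h2 := f.nonneg (x := x)
    nlinarith
  · have : f x = 0 := by
      refine f.zero_of_le_dist ?_
      by_contra! hlt
      exact absurd (hball (Metric.mem_ball.2 hlt)) (not_lt.2 hx)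
    simp [this]

theorem exists_gauge_fourier_bound (hg_cont : Continuous g) (hg_pos : ∀ x, x ≠ 0 → 0 < g x)
    (hg_hom : ∀ t : ℝ, 0 < t → ∀ x, g (t • x) = t * g x)
    (hg_smooth : ContDiffOn ℝ ∞ g {(0 : Fin n → ℝ)}ᶜ)
    (hg_nondeg : ∀ x : Fin n → ℝ, x ≠ 0 → ∀ v : Fin n → ℝ,
      (∀ w : Fin n → ℝ, fderiv ℝ (fun y => fderiv ℝ g y) x v w = 0) ↔ ∃ c : ℝ, v = c • x)
    {H : ℝ → ℝ} (hH : ContDiff ℝ ∞ H) (hH1 : ∀ s ≤ -1, H s = 1) (hH0 : ∀ s, 1 ≤ s → H s = 0)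
    (M : ℕ) :
    ∃ C : ℝ, ∀ δ : ℝ, 0 < δ → δ ≤ 1 / 4 → ∀ ξ : (Fin n → ℝ) →L[ℝ] ℝ, 1 ≤ ‖ξ‖ →
      (1 + δ * ‖ξ‖) ^ M * ‖∫ x, (H ((g x - 1) / δ) : ℂ) *
        Complex.exp (-(Complex.I * (ξ x : ℝ)))‖ ≤ C * ‖ξ‖ ^ (-((n + 1) / 2 : ℝ)) := by
  obtain ⟨G, hG, hGle, hGg⟩ := exists_contDiff_eq_gauge hg_cont hg_pos hg_hom hg_smooth
  have hx0 : ∀ x, 1 / 2 ≤ G x → x ≠ 0 := by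
    rintro x hx rfl
    have := hGle 0
    rw [gaugeFunction_zero hg_hom] at this
    linarith
  have hsm : ∀ x, x ≠ 0 → ContDiffAt ℝ ∞ g x := fun x hx =>
    hg_smooth.contDiffAt (isOpen_compl_singleton.mem_nhds hx)
  have hev : ∀ x, 1 / 2 ≤ G x → G =ᶠ[𝓝 x] g := fun x hx => by
    filter_upwards [hg_cont.continuousAt.eventually (lt_mem_nhds
      (show 1 / 4 < g x by linarith [hGle x]))] with y hy
    exact hGg y hy.le
  have hGc : IsCompact {x | G x ≤ 3 / 2} := by
    refine (isCompact_gauge_le hg_cont hg_pos hg_hom (3 / 2)).of_isClosed_subset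
      (isClosed_le hG.continuous continuous_const) fun x hx => ?_
    rw [Set.mem_ofPred_eq] at hx ⊢
    by_cases h : 1 / 4 ≤ g x
    · rwa [← hGg x h]
    · linarith
  obtain ⟨C, hC⟩ := exists_fourier_bound hG hGc (fun x hx _ h => by
      rw [(hev x hx).fderiv_eq] at h
      have h1 := fderiv_gauge_apply_self hg_hom ((hsm x (hx0 x hx)).differentiableAt (by simp))
      rw [h] at h1
      exact (hg_pos x (hx0 x hx)).ne h1)
    (fun x hx _ m ν v hm hv h => by
      simp only [(hev x hx).fderiv_eq, (hev x hx).fderiv.fderiv_eq] at hv h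
      exact eq_zero_of_hessian_add_fderiv_eq_zero hg_pos hg_hom (hx0 x hx) (hsm x (hx0 x hx))
        (hg_nondeg x (hx0 x hx)) hm hv h) hH hH1 hH0 M
  refine ⟨C, fun δ hδ hδ4 ξ hξ => ?_⟩
  have hHG : ∀ x, H ((g x - 1) / δ) = H ((G x - 1) / δ) := by
    intro x
    by_cases h : 1 / 4 ≤ g x
    · rw [hGg x h]
    · have := hGle x
      rw [hH1 _ ((div_le_iff₀ hδ).2 (by linarith)), hH1 _ ((div_le_iff₀ hδ).2 (by linarith))]
  simp only [hHG]
  exact hC δ hδ hδ4 ξ hξ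

theorem exists_smoothed_count_bound (hn : 2 ≤ n) (hg_cont : Continuous g)
    (hg_pos : ∀ x, x ≠ 0 → 0 < g x)
    (hg_hom : ∀ t : ℝ, 0 < t → ∀ x, g (t • x) = t * g x)
    (hg_smooth : ContDiffOn ℝ ∞ g {(0 : Fin n → ℝ)}ᶜ)
    (hg_nondeg : ∀ x : Fin n → ℝ, x ≠ 0 → ∀ v : Fin n → ℝ,
      (∀ w : Fin n → ℝ, fderiv ℝ (fun y => fderiv ℝ g y) x v w = 0) ↔ ∃ c : ℝ, v = c • x)
    {H : ℝ → ℝ} (hH : ContDiff ℝ ∞ H) (hH1 : ∀ s ≤ -1, H s = 1) (hH0 : ∀ s, 1 ≤ s → H s = 0) :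
    ∃ C : ℝ, ∀ δ : ℝ, 0 < δ → δ ≤ 1 / 4 → ∀ R : ℝ, 1 ≤ R →
      |(∑ᶠ k : Fin n → ℤ, H ((g (R⁻¹ • fun i => (k i : ℝ)) - 1) / δ)) -
        R ^ n * ∫ x, H ((g x - 1) / δ)| ≤ C * δ ^ (-((n - 1) / 2 : ℝ)) := by
  obtain ⟨K, -, hK⟩ := exists_norm_finsum_sub_integral_le hn
  obtain ⟨C, hC⟩ :=
    exists_gauge_fourier_bound hg_cont hg_pos hg_hom hg_smooth hg_nondeg hH hH1 hH0 n
  refine ⟨K * C, fun δ hδ hδ4 R hR => ?_⟩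
  have hHc := hH.continuous
  have hc : HasCompactSupport fun x => (H ((g x - 1) / δ) : ℂ) := by
    refine HasCompactSupport.intro (isCompact_gauge_le hg_cont hg_pos hg_hom (1 + δ)) fun x hx => ?_
    rw [Set.mem_ofPred_eq, not_le] at hx
    rw [hH0 _ ((le_div_iff₀ hδ).2 (by linarith)), Complex.ofReal_zero]
  have h := hK (fun x => (H ((g x - 1) / δ) : ℂ)) (by fun_prop) hc C δ hδ (hC δ hδ hδ4) R hR
  have h1 : ∑ᶠ k : Fin n → ℤ, (H ((g (R⁻¹ • fun i => (k i : ℝ)) - 1) / δ) : ℂ) =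
      ((∑ᶠ k : Fin n → ℤ, H ((g (R⁻¹ • fun i => (k i : ℝ)) - 1) / δ) : ℝ) : ℂ) :=
    (Complex.ofRealHom.toAddMonoidHom.map_finsum_of_injective Complex.ofReal_injective _).symm
  have h2 : ∫ x, (H ((g x - 1) / δ) : ℂ) = ((∫ x, H ((g x - 1) / δ) : ℝ) : ℂ) := integral_ofReal
  rw [h1, h2] at h
  rw [← Real.norm_eq_abs, ← Complex.norm_real]
  push_cast
  exact h

end Gauge

section GaugeVolume

variable {n : ℕ} {g : (Fin n → ℝ) → ℝ}

open scoped Pointwise in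
theorem volume_gauge_lt_toReal (hg_hom : ∀ t : ℝ, 0 < t → ∀ x, g (t • x) = t * g x) {t : ℝ}
    (ht : 0 < t) :
    (volume {x : Fin n → ℝ | g x < t}).toReal =
      t ^ n * (volume {x : Fin n → ℝ | g x < 1}).toReal := by
  have : {x : Fin n → ℝ | g x < t} = t • {x : Fin n → ℝ | g x < 1} := by
    ext x
    rw [Set.mem_smul_set_iff_inv_smul_mem₀ ht.ne', Set.mem_ofPred_eq, Set.mem_ofPred_eq,
      hg_hom _ (inv_pos.2 ht), ← div_eq_inv_mul, div_lt_one ht]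
  rw [this, Measure.addHaar_smul, Module.finrank_fin_fun, ENNReal.toReal_mul,
    ENNReal.toReal_ofReal (by positivity), abs_of_pos (by positivity)]

theorem volume_gauge_lt_lt_top (hg_cont : Continuous g) (hg_pos : ∀ x, x ≠ 0 → 0 < g x)
    (hg_hom : ∀ t : ℝ, 0 < t → ∀ x, g (t • x) = t * g x) (t : ℝ) :
    volume {x : Fin n → ℝ | g x < t} < ⊤ :=
  (measure_mono fun x (hx : g x < t) => show g x ≤ t from hx.le).trans_lt
    (isCompact_gauge_le hg_cont hg_pos hg_hom t).measure_lt_top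

theorem finite_setOf_gauge_intCast_le (hg_cont : Continuous g) (hg_pos : ∀ x, x ≠ 0 → 0 < g x)
    (hg_hom : ∀ t : ℝ, 0 < t → ∀ x, g (t • x) = t * g x) (t : ℝ) :
    {k : Fin n → ℤ | g (fun i => (k i : ℝ)) ≤ t}.Finite := by
  obtain ⟨c, hc, h⟩ := exists_mul_norm_le_gauge hg_cont hg_pos hg_hom
  refine (finite_setOf_norm_intCast_le n (t / c)).subset fun k hk => ?_
  rw [Set.mem_ofPred_eq, le_div_iff₀' hc]
  exact (h _).trans hk

/-- The number of integer points in a dilate of the body lies between smoothed counts. -/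
theorem finsum_le_card_le_finsum (hg_cont : Continuous g) (hg_pos : ∀ x, x ≠ 0 → 0 < g x)
    (hg_hom : ∀ t : ℝ, 0 < t → ∀ x, g (t • x) = t * g x) {R B : ℝ} (hR : 0 < R)
    {φ ψ : (Fin n → ℝ) → ℝ} (hφB : ∀ x, B ≤ g x → φ x = 0) (hψB : ∀ x, B ≤ g x → ψ x = 0)
    (hφ1 : ∀ x, φ x ≤ 1) (hφ0 : ∀ x, 1 ≤ g x → φ x ≤ 0)
    (hψ0 : ∀ x, 0 ≤ ψ x) (hψ1 : ∀ x, g x < 1 → 1 ≤ ψ x) :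
    ∑ᶠ k : Fin n → ℤ, φ (R⁻¹ • fun i => (k i : ℝ)) ≤
        Nat.card {k : Fin n → ℤ // g (fun i => (k i : ℝ)) < R} ∧
      (Nat.card {k : Fin n → ℤ // g (fun i => (k i : ℝ)) < R} : ℝ) ≤
        ∑ᶠ k : Fin n → ℤ, ψ (R⁻¹ • fun i => (k i : ℝ)) := by
  classical
  have hgR : ∀ x, g (R⁻¹ • x) = g x / R := fun x => by
    rw [hg_hom _ (inv_pos.2 hR), div_eq_inv_mul]
  set T := (finite_setOf_gauge_intCast_le hg_cont hg_pos hg_hom (R * max B 1)).toFinset with hT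
  have hmem : ∀ k, k ∈ T ↔ g (fun i => (k i : ℝ)) ≤ R * max B 1 := by simp [hT]
  have hsupp : ∀ χ : (Fin n → ℝ) → ℝ, (∀ x, B ≤ g x → χ x = 0) →
      ∑ᶠ k : Fin n → ℤ, χ (R⁻¹ • fun i => (k i : ℝ)) =
        ∑ k ∈ T, χ (R⁻¹ • fun i => (k i : ℝ)) := by
    intro χ hχ
    refine finsum_eq_sum_of_support_subset _ fun k hk => ?_
    by_contra hkT
    refine hk (hχ _ ?_)
    rw [Finset.mem_coe, hmem, not_le] at hkT
    rw [hgR, le_div_iff₀ hR, mul_comm]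
    exact (mul_le_mul_of_nonneg_left (le_max_left _ _) hR.le).trans hkT.le
  have hcard : (Nat.card {k : Fin n → ℤ // g (fun i => (k i : ℝ)) < R} : ℝ) =
      ∑ k ∈ T, if g (fun i => (k i : ℝ)) < R then 1 else 0 := by
    rw [Nat.subtype_card (T.filter fun k => g (fun i => (k i : ℝ)) < R), Finset.card_filter]
    · push_cast
      rfl
    · intro k
      rw [Finset.mem_filter, hmem, and_iff_right_iff_imp]
      intro h
      nlinarith [le_max_right B 1]
  rw [hsupp φ hφB, hsupp ψ hψB, hcard]
  constructor
  · refine Finset.sum_le_sum fun k _ => ?_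
    split_ifs with h
    · exact hφ1 _
    · exact hφ0 _ (by rw [hgR, le_div_iff₀ hR]; linarith)
  · refine Finset.sum_le_sum fun k _ => ?_
    split_ifs with h
    · exact hψ1 _ (by rw [hgR, div_lt_one hR]; exact h)
    · exact hψ0 _

end GaugeVolume

theorem one_add_pow_le_one_add_three_pow_mul {δ : ℝ} (h0 : 0 ≤ δ) (h1 : δ ≤ 1) (n : ℕ) :
    (1 + δ) ^ n ≤ 1 + 3 ^ n * δ := by
  induction n with
  | zero => simpa using h0
  | succ n ih =>
    have h3 : (1 : ℝ) ≤ 3 ^ n := one_le_pow₀ (by norm_num)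
    calc (1 + δ) ^ (n + 1) = (1 + δ) ^ n * (1 + δ) := pow_succ _ _
      _ ≤ (1 + 3 ^ n * δ) * (1 + δ) := by gcongr
      _ ≤ 1 + 3 ^ (n + 1) * δ := by
        rw [pow_succ]
        nlinarith [mul_nonneg h0 (sub_nonneg.2 h3), mul_nonneg h0 (sub_nonneg.2 h1),
          mul_nonneg (mul_nonneg h0 (sub_nonneg.2 h1)) (zero_le_one.trans h3)]

section Counting

variable {n : ℕ} {g : (Fin n → ℝ) → ℝ}

theorem exists_abs_card_sub_le_of_smoothing (hn : 2 ≤ n) (hg_cont : Continuous g)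
    (hg_pos : ∀ x, x ≠ 0 → 0 < g x)
    (hg_hom : ∀ t : ℝ, 0 < t → ∀ x, g (t • x) = t * g x)
    (hg_smooth : ContDiffOn ℝ ∞ g {(0 : Fin n → ℝ)}ᶜ)
    (hg_nondeg : ∀ x : Fin n → ℝ, x ≠ 0 → ∀ v : Fin n → ℝ,
      (∀ w : Fin n → ℝ, fderiv ℝ (fun y => fderiv ℝ g y) x v w = 0) ↔ ∃ c : ℝ, v = c • x) :
    ∃ C : ℝ, 0 ≤ C ∧ ∀ δ : ℝ, 0 < δ → δ ≤ 1 / 4 → ∀ R : ℝ, 1 ≤ R →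
      |(Nat.card {k : Fin n → ℤ // g (fun i => (k i : ℝ)) < R} : ℝ) -
        R ^ n * (volume {x : Fin n → ℝ | g x < 1}).toReal| ≤
        C * (δ ^ (-((n - 1) / 2 : ℝ)) + R ^ n * δ) := by
  obtain ⟨A, hA⟩ := exists_smoothed_count_bound hn hg_cont hg_pos hg_hom hg_smooth hg_nondeg
    (H := fun s => Real.smoothTransition (-s)) (by fun_prop)
    (fun s hs => Real.smoothTransition.one_of_one_le (by linarith))
    (fun s hs => Real.smoothTransition.zero_of_nonpos (by linarith))
  obtain ⟨B, hB⟩ := exists_smoothed_count_bound hn hg_cont hg_pos hg_hom hg_smooth hg_nondeg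
    (H := fun s => Real.smoothTransition (1 - s)) (by fun_prop)
    (fun s hs => Real.smoothTransition.one_of_one_le (by linarith))
    (fun s hs => Real.smoothTransition.zero_of_nonpos (by linarith))
  set V := (volume {x : Fin n → ℝ | g x < 1}).toReal with hV
  have hV0 : 0 ≤ V := ENNReal.toReal_nonneg
  refine ⟨max |A| |B| + 3 ^ n * V, by positivity, fun δ hδ hδ4 R hR => ?_⟩
  have hR0 : 0 < R := by linarith
  set φ : (Fin n → ℝ) → ℝ := fun x => Real.smoothTransition (-((g x - 1) / δ)) with hφ
  set ψ : (Fin n → ℝ) → ℝ := fun x => Real.smoothTransition (1 - (g x - 1) / δ) with hψ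
  have hφz : ∀ x, 1 ≤ g x → φ x = 0 := fun x hx =>
    Real.smoothTransition.zero_of_nonpos (neg_nonpos.2 (div_nonneg (by linarith) hδ.le))
  have hψz : ∀ x, 1 + δ ≤ g x → ψ x = 0 := fun x hx =>
    Real.smoothTransition.zero_of_nonpos (by
      rw [sub_nonpos, le_div_iff₀ hδ]
      linarith)
  have hψo : ∀ x, g x < 1 → ψ x = 1 := fun x hx =>
    Real.smoothTransition.one_of_one_le (by
      have : (g x - 1) / δ ≤ 0 := div_nonpos_of_nonpos_of_nonneg (by linarith) hδ.le
      linarith)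
  have hφo : ∀ x, g x < 1 - δ → φ x = 1 := fun x hx =>
    Real.smoothTransition.one_of_one_le (by
      rw [← neg_div, le_div_iff₀ hδ]
      linarith)
  have hint : ∀ χ : (Fin n → ℝ) → ℝ, Continuous χ → (∀ x, 1 + δ ≤ g x → χ x = 0) →
      Integrable χ := fun χ hχ h0 =>
    hχ.integrable_of_hasCompactSupport (HasCompactSupport.intro
      (isCompact_gauge_le hg_cont hg_pos hg_hom (1 + δ)) fun x hx => h0 x (not_le.1 hx).le)
  have hst := Real.smoothTransition.continuous
  have hφi : Integrable φ := hint φ (by fun_prop) fun x hx => hφz x (by linarith)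
  have hψi : Integrable ψ := hint ψ (by fun_prop) hψz
  have hind : ∀ t : ℝ, 0 < t → MeasurableSet {x : Fin n → ℝ | g x < t} ∧
      Integrable ({x : Fin n → ℝ | g x < t}.indicator fun _ => (1 : ℝ)) ∧
      ∫ x, {x : Fin n → ℝ | g x < t}.indicator (fun _ => (1 : ℝ)) x = t ^ n * V := by
    intro t ht
    have hm : MeasurableSet {x : Fin n → ℝ | g x < t} :=
      measurableSet_lt hg_cont.measurable measurable_const
    refine ⟨hm, (integrable_indicator_iff hm).2 (integrableOn_const
      (volume_gauge_lt_lt_top hg_cont hg_pos hg_hom t).ne), ?_⟩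
    rw [integral_indicator_const _ hm, smul_eq_mul, mul_one, measureReal_def,
      volume_gauge_lt_toReal hg_hom ht]
  obtain ⟨-, hi1, hv1⟩ := hind (1 - δ) (by linarith)
  obtain ⟨-, hi2, hv2⟩ := hind (1 + δ) (by linarith)
  have hlow : (1 - δ) ^ n * V ≤ ∫ x, φ x := by
    rw [← hv1]
    refine integral_mono hi1 hφi fun x => Set.indicator_le' (fun x hx => (hφo x hx).ge)
      (fun x _ => Real.smoothTransition.nonneg _) x
  have hupp : ∫ x, ψ x ≤ (1 + δ) ^ n * V := by
    rw [← hv2]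
    refine integral_mono hψi hi2 fun x => ?_
    by_cases hx : g x < 1 + δ
    · rw [Set.indicator_of_mem (s := {x : Fin n → ℝ | g x < 1 + δ}) hx]
      exact Real.smoothTransition.le_one _
    · rw [Set.indicator_of_notMem (s := {x : Fin n → ℝ | g x < 1 + δ}) hx]
      exact (hψz x (not_lt.1 hx)).le
  obtain ⟨hN1, hN2⟩ := finsum_le_card_le_finsum hg_cont hg_pos hg_hom (R := R) (B := 1 + δ) hR0
    (fun x hx => hφz x (by linarith)) hψz (fun x => Real.smoothTransition.le_one _)
    (fun x hx => (hφz x hx).le) (fun x => Real.smoothTransition.nonneg _)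
    (fun x hx => (hψo x hx).ge)
  have hA' := abs_le.1 (hA δ hδ hδ4 R hR)
  have hB' := abs_le.1 (hB δ hδ hδ4 R hR)
  have hE : 0 ≤ δ ^ (-((n - 1) / 2 : ℝ)) := by positivity
  have hAE : A * δ ^ (-((n - 1) / 2 : ℝ)) ≤ max |A| |B| * δ ^ (-((n - 1) / 2 : ℝ)) := by
    gcongr
    exact (le_abs_self A).trans (le_max_left _ _)
  have hBE : B * δ ^ (-((n - 1) / 2 : ℝ)) ≤ max |A| |B| * δ ^ (-((n - 1) / 2 : ℝ)) := by
    gcongr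
    exact (le_abs_self B).trans (le_max_right _ _)
  have hRn : 0 ≤ R ^ n := by positivity
  have hup' : R ^ n * ∫ x, ψ x ≤ R ^ n * V + 3 ^ n * V * (R ^ n * δ) := by
    have h := one_add_pow_le_one_add_three_pow_mul hδ.le (by linarith) n
    calc R ^ n * ∫ x, ψ x ≤ R ^ n * ((1 + 3 ^ n * δ) * V) := by
          gcongr
          exact hupp.trans (by gcongr)
      _ = _ := by ring
  have hlo' : R ^ n * V - 3 ^ n * V * (R ^ n * δ) ≤ R ^ n * ∫ x, φ x := by
    have h := one_add_mul_le_pow (a := -δ) (by linarith) n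
    have h3 : (n : ℝ) ≤ 3 ^ n := by exact_mod_cast (Nat.lt_pow_self (by norm_num)).le
    calc R ^ n * V - 3 ^ n * V * (R ^ n * δ) = R ^ n * ((1 - 3 ^ n * δ) * V) := by ring
      _ ≤ R ^ n * ((1 - δ) ^ n * V) := by
        gcongr
        rw [← sub_eq_add_neg] at h
        refine le_trans ?_ h
        nlinarith
      _ ≤ _ := by gcongr
  have hx1 : 0 ≤ max |A| |B| * (R ^ n * δ) := by positivity
  have hx2 : 0 ≤ 3 ^ n * V * δ ^ (-((n - 1) / 2 : ℝ)) := by positivity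
  rw [abs_le, add_mul, mul_add, mul_add]
  constructor <;> linarith [hA'.1, hB'.2]

end Counting

/-- Counting lattice points in dilates of a star-shaped body with smooth
boundary and non-degenerate second fundamental form. -/
theorem lattice_count_asymptotics
    (n : ℕ) (hn : 2 ≤ n)
    (g : (Fin n → ℝ) → ℝ)
    (hg_cont : Continuous g)
    (hg_pos : ∀ x : Fin n → ℝ, x ≠ 0 → 0 < g x)
    (hg_hom : ∀ t : ℝ, 0 < t → ∀ x : Fin n → ℝ, g (t • x) = t * g x)
    (hg_smooth : ContDiffOn ℝ (⊤ : ℕ∞) g {(0 : Fin n → ℝ)}ᶜ)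
    (hg_nondeg : ∀ x : Fin n → ℝ, x ≠ 0 → ∀ v : Fin n → ℝ,
      (∀ w : Fin n → ℝ, fderiv ℝ (fun y => fderiv ℝ g y) x v w = 0) ↔ ∃ c : ℝ, v = c • x) :
    ∃ C : ℝ, 0 < C ∧ ∀ L : ℝ, 1 ≤ L →
      |(Nat.card {k : Fin n → ℤ // g (fun i => (k i : ℝ)) < Real.sqrt L} : ℝ)
        - L ^ ((n : ℝ) / 2) * (MeasureTheory.volume {x : Fin n → ℝ | g x < 1}).toReal|
      ≤ C * L ^ ((n : ℝ) / 2 - n / (n + 1)) := by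
  obtain ⟨C, hC0, hC⟩ := exists_abs_card_sub_le_of_smoothing hn hg_cont hg_pos hg_hom hg_smooth
    hg_nondeg
  have hc : (0 : ℝ) < (1 / 4) ^ (-((n - 1) / 2 : ℝ)) := by positivity
  refine ⟨(C + 1) * ((1 / 4) ^ (-((n - 1) / 2 : ℝ)) + 1 / 4), by positivity, fun L hL => ?_⟩
  have hL0 : 0 < L := by linarith
  have hRn : Real.sqrt L ^ n = L ^ ((n : ℝ) / 2) := by
    rw [Real.sqrt_eq_rpow, ← Real.rpow_natCast, ← Real.rpow_mul hL0.le]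
    congr 1
    ring
  have hLe : L ^ (-(n / (n + 1)) : ℝ) ≤ 1 :=
    Real.rpow_le_one_of_one_le_of_nonpos hL (neg_nonpos.2 (by positivity))
  have h := hC (1 / 4 * L ^ (-(n / (n + 1)) : ℝ)) (by positivity) (by linarith) (Real.sqrt L)
    (Real.one_le_sqrt.2 hL)
  rw [hRn] at h
  refine h.trans ?_
  have h1 : (1 / 4 * L ^ (-(n / (n + 1)) : ℝ)) ^ (-((n - 1) / 2 : ℝ)) =
      (1 / 4) ^ (-((n - 1) / 2 : ℝ)) * L ^ ((n : ℝ) / 2 - n / (n + 1)) := by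
    rw [Real.mul_rpow (by norm_num) (by positivity), ← Real.rpow_mul hL0.le]
    congr 2
    field_simp
    ring
  have h2 : L ^ ((n : ℝ) / 2) * (1 / 4 * L ^ (-(n / (n + 1)) : ℝ)) =
      1 / 4 * L ^ ((n : ℝ) / 2 - n / (n + 1)) := by
    rw [sub_eq_add_neg, Real.rpow_add hL0]
    ring
  rw [h1, h2, ← add_mul, ← mul_assoc]
  gcongr
  linarith
end

section
/- Let M be a complex symmetric n×n matrix (Mᵀ = M) whose real part Re M is positive definite. Then the function x ↦ exp(−xᵀMx) is integrable on ℝⁿ, det M ≠ 0, and ( ∫_{ℝⁿ} exp(−xᵀMx) dx )² = πⁿ / det M. -/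
open MeasureTheory

section SimultaneousDiagonalization

open Matrix
open scoped MatrixOrder

/-- A positive definite real matrix and a symmetric real matrix are simultaneously diagonalizable
by congruence. -/
theorem Matrix.PosDef.exists_simultaneous_diagonalization {ι : Type*} [Fintype ι] [DecidableEq ι]
    {A B : Matrix ι ι ℝ} (hA : A.PosDef) (hB : B.IsHermitian) :
    ∃ (P : Matrix ι ι ℝ) (d : ι → ℝ), P.det ≠ 0 ∧ Pᵀ * A * P = 1 ∧ Pᵀ * B * P = diagonal d := by
  obtain ⟨C, rfl⟩ := CStarAlgebra.nonneg_iff_eq_star_mul_self.mp hA.posSemidef.nonneg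
  rw [star_eq_conjTranspose, conjTranspose_eq_transpose_of_trivial] at *
  have hC : IsUnit C.det := by
    have h := hA.det_pos.ne'
    rw [det_mul, det_transpose] at h
    exact isUnit_iff_ne_zero.mpr (left_ne_zero_of_mul h)
  have hB' : (C⁻¹ᵀ * B * C⁻¹).IsHermitian := by
    simpa using isHermitian_conjTranspose_mul_mul C⁻¹ hB
  have hU := mem_unitaryGroup_iff'.mp hB'.eigenvectorUnitary.2
  have hdiag := hB'.conjStarAlgAut_star_eigenvectorUnitary
  rw [Unitary.conjStarAlgAut_star_apply] at hdiag
  set U : Matrix ι ι ℝ := (hB'.eigenvectorUnitary : Matrix ι ι ℝ)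
  rw [star_eq_conjTranspose, conjTranspose_eq_transpose_of_trivial] at hU hdiag
  have hCC : C⁻¹ᵀ * Cᵀ = 1 := by rw [← transpose_mul, mul_nonsing_inv _ hC, transpose_one]
  refine ⟨C⁻¹ * U, hB'.eigenvalues, ?_, ?_, ?_⟩
  · have hU' : U.det ≠ 0 := fun h ↦ by simpa [h] using congrArg det hU
    rw [det_mul]
    exact mul_ne_zero (isUnit_nonsing_inv_det C hC).ne_zero hU'
  · calc (C⁻¹ * U)ᵀ * (Cᵀ * C) * (C⁻¹ * U) = Uᵀ * ((C⁻¹ᵀ * Cᵀ) * (C * C⁻¹)) * U := by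
          simp only [transpose_mul, mul_assoc]
      _ = 1 := by rw [hCC, mul_nonsing_inv _ hC, mul_one, mul_one, hU]
  · rw [transpose_mul]
    simpa only [mul_assoc] using! hdiag

end SimultaneousDiagonalization

section ChangeOfVariables

open Matrix

variable {ι E : Type*} [Fintype ι] [DecidableEq ι] [NormedAddCommGroup E] {P : Matrix ι ι ℝ}

theorem Matrix.measurableEmbedding_mulVec (hP : P.det ≠ 0) :
    MeasurableEmbedding (fun x : ι → ℝ ↦ P *ᵥ x) := by
  have hinj : Function.Injective (fun x : ι → ℝ ↦ P *ᵥ x) :=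
    mulVec_injective_iff_isUnit.mpr ((isUnit_iff_isUnit_det P).mpr hP.isUnit)
  exact (Continuous.matrix_mulVec continuous_const continuous_id).measurableEmbedding hinj

theorem Matrix.map_mulVec_volume (hP : P.det ≠ 0) :
    (volume : Measure (ι → ℝ)).map (fun x ↦ P *ᵥ x) = ENNReal.ofReal |P.det⁻¹| • volume :=
  Real.map_matrix_volume_pi_eq_smul_volume_pi hP

theorem Matrix.integrable_comp_mulVec_iff (hP : P.det ≠ 0) (f : (ι → ℝ) → E) :
    Integrable (fun x ↦ f (P *ᵥ x)) ↔ Integrable f := by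
  have h := (measurableEmbedding_mulVec hP).integrable_map_iff (μ := volume) (g := f)
  rw [map_mulVec_volume hP, integrable_smul_measure (by simpa using hP) ENNReal.ofReal_ne_top] at h
  exact h.symm

theorem Matrix.integral_comp_mulVec [NormedSpace ℝ E] (hP : P.det ≠ 0) (f : (ι → ℝ) → E) :
    ∫ x, f (P *ᵥ x) = |P.det⁻¹| • ∫ x, f x := by
  rw [← (measurableEmbedding_mulVec hP).integral_map (μ := volume) f, map_mulVec_volume hP,
    integral_smul_measure, ENNReal.toReal_ofReal (abs_nonneg _)]

end ChangeOfVariables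

open Matrix in
/-- A complex symmetric matrix with positive definite real part is diagonalizable by a real
congruence, to a diagonal matrix whose entries have real part `1`. -/
theorem Matrix.exists_real_congruence_diagonal {ι : Type*} [Fintype ι] [DecidableEq ι]
    {M : Matrix ι ι ℂ} (hM : Mᵀ = M) (hre : (M.map Complex.re).PosDef) :
    ∃ (P : Matrix ι ι ℝ) (b : ι → ℂ), P.det ≠ 0 ∧ (∀ i, (b i).re = 1) ∧
      (P.map Complex.ofReal)ᵀ * M * P.map Complex.ofReal = diagonal b := by
  have him : (M.map Complex.im).IsHermitian := by
    rw [IsHermitian, conjTranspose_eq_transpose_of_trivial, ← transpose_map, hM]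
  obtain ⟨P, d, hP, h1, hd⟩ := hre.exists_simultaneous_diagonalization him
  refine ⟨P, fun i ↦ 1 + d i * Complex.I, hP, fun i ↦ by simp, ?_⟩
  have hsplit : M = (M.map Complex.re).map Complex.ofRealHom +
      Complex.I • (M.map Complex.im).map Complex.ofRealHom := by
    ext i j
    simp [mul_comm Complex.I, Complex.re_add_im]
  have h1' := congrArg (fun A ↦ A.map Complex.ofRealHom) h1
  have hd' := congrArg (fun A ↦ A.map Complex.ofRealHom) hd
  simp only [Matrix.map_mul, transpose_map] at h1' hd'
  change (P.map Complex.ofRealHom)ᵀ * M * P.map Complex.ofRealHom = _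
  rw [hsplit, Matrix.mul_add, Matrix.add_mul, Matrix.mul_smul, Matrix.smul_mul, h1', hd']
  ext i j
  obtain rfl | hij := eq_or_ne i j
  · simp [mul_comm]
  · simp [hij]

/-- Gaussian integral of a complex symmetric matrix with positive definite
real part: the integral of exp(-xᵀMx) over ℝⁿ squares to πⁿ / det M. -/
theorem complex_gaussian_integral
    (n : ℕ)
    (M : Matrix (Fin n) (Fin n) ℂ)
    (hM_symm : M.transpose = M)
    (hM_pos : ∀ x : Fin n → ℝ, x ≠ 0 → 0 < ∑ j, ∑ k, (M j k).re * x j * x k) :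
    Integrable (fun x : Fin n → ℝ =>
        Complex.exp (-(∑ j, ∑ k, M j k * (x j : ℂ) * (x k : ℂ)))) volume
    ∧ M.det ≠ 0
    ∧ (∫ x : Fin n → ℝ,
        Complex.exp (-(∑ j, ∑ k, M j k * (x j : ℂ) * (x k : ℂ)))) ^ 2
      = (Real.pi : ℂ) ^ n / M.det := by
  have hre : (M.map Complex.re).PosDef := by
    refine .of_dotProduct_mulVec_pos ?_ fun x hx ↦ ?_
    · rw [Matrix.IsHermitian, Matrix.conjTranspose_eq_transpose_of_trivial, ← Matrix.transpose_map,
        hM_symm]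
    · refine (hM_pos x hx).trans_eq ?_
      simp only [dotProduct, Matrix.mulVec, Finset.mul_sum, Matrix.map_apply, star_trivial]
      exact Finset.sum_congr rfl fun j _ ↦ Finset.sum_congr rfl fun k _ ↦ by ring
  obtain ⟨P, b, hP, hb, hPM⟩ := Matrix.exists_real_congruence_diagonal hM_symm hre
  have hb0 (i) : b i ≠ 0 := fun h ↦ by simpa [h] using hb i
  have hb_pos (i) : 0 < (b i).re := by simp [hb i]
  have hdet : (P.det : ℂ) ^ 2 * M.det = ∏ i, b i := by
    have h := congrArg Matrix.det hPM
    have hPdet : (P.map Complex.ofReal).det = P.det := (Complex.ofRealHom.map_det P).symm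
    rw [Matrix.det_mul, Matrix.det_mul, Matrix.det_transpose, Matrix.det_diagonal, hPdet] at h
    rw [← h]
    ring
  have hdet0 : M.det ≠ 0 := by
    refine right_ne_zero_of_mul (a := (P.det : ℂ) ^ 2) ?_
    rw [hdet]
    exact Finset.prod_ne_zero_iff.mpr fun i _ ↦ hb0 i
  set f : (Fin n → ℝ) → ℂ :=
    fun x ↦ Complex.exp (-(∑ j, ∑ k, M j k * (x j : ℂ) * (x k : ℂ))) with hf
  have hquad (N : Matrix (Fin n) (Fin n) ℂ) (v : Fin n → ℂ) :
      ∑ j, ∑ k, N j k * v j * v k = v ⬝ᵥ N.mulVec v := by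
    simp only [dotProduct, Matrix.mulVec, Finset.mul_sum]
    exact Finset.sum_congr rfl fun j _ ↦ Finset.sum_congr rfl fun k _ ↦ by ring
  have hfP : (fun x ↦ f (P.mulVec x)) =
      fun x ↦ Complex.exp (-∑ i, b i * (x i : ℂ) ^ 2 + ∑ i, (0 : Fin n → ℂ) i * x i) := by
    funext x
    have hx : (fun j ↦ ((P.mulVec x j : ℝ) : ℂ)) =
        (P.map Complex.ofReal).mulVec (fun i ↦ (x i : ℂ)) := by
      ext j
      simp [Matrix.mulVec, dotProduct]
    have hx' := hquad M (fun j ↦ ((P.mulVec x j : ℝ) : ℂ))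
    simp only [hf, hx', Pi.zero_apply, zero_mul, Finset.sum_const_zero, add_zero]
    rw [hx, Matrix.mulVec_mulVec, ← Matrix.vecMul_transpose, ← Matrix.dotProduct_mulVec,
      Matrix.mulVec_mulVec, ← mul_assoc, hPM]
    simp only [dotProduct, Matrix.mulVec_diagonal]
    congr 2
    exact Finset.sum_congr rfl fun j _ ↦ by ring
  refine ⟨?_, hdet0, ?_⟩
  · rw [← Matrix.integrable_comp_mulVec_iff hP, hfP]
    exact GaussianFourier.integrable_cexp_neg_sum_mul_add hb_pos 0
  · have hint := Matrix.integral_comp_mulVec hP f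
    rw [hfP, GaussianFourier.integral_cexp_neg_sum_mul_add hb_pos 0] at hint
    have hsq := congrArg (· ^ 2) hint
    have hroot (z : ℂ) : (z ^ (1 / 2 : ℂ)) ^ 2 = z := by
      rw [one_div]
      exact_mod_cast Complex.cpow_nat_inv_pow z two_ne_zero
    have habs : ((|P.det⁻¹| : ℝ) : ℂ) ^ 2 = ((P.det : ℂ) ^ 2)⁻¹ := by
      rw [← Complex.ofReal_pow, sq_abs]
      simp
    have hP0 : (P.det : ℂ) ≠ 0 := by exact_mod_cast hP
    simp only [Pi.zero_apply, ne_eq, OfNat.ofNat_ne_zero, not_false_eq_true, zero_pow, zero_div,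
      Complex.exp_zero, mul_one, ← Finset.prod_pow, hroot, Complex.real_smul, mul_pow, habs,
      Finset.prod_div_distrib, Finset.prod_const, Finset.card_univ, Fintype.card_fin,
      ← hdet] at hsq
    field_simp at hsq ⊢
    linear_combination -hsq
end
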